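/- arXiv:1801.03217 — 3 statements merged into one kernel-verified Lean document; each statement's English description precedes it below -/
import Mathlib

section
/- Under the conditions of Theorem 1 (critical aperiodic GW process with variance 2B ∈ (0,∞), φ(n)→∞, φ(n)=o(n)), for every x > 0 and j ≥ 1: lim_{n→∞} P(Z(n - ⌊xφ(n)⌋, n) = j | 0 < Z(n) ≤ Bφ(n)) = (x/(j-1)!) ∫_0^{1/x} z^{j-1} e^{-z} dz. -/
open MeasureTheory Filter Topology Asymptotics Real

/-- Probability generating function of the offspring distribution `p`. -/
noncomputable def pgf (p : ℕ → ℝ) (s : ℝ) : ℝ := ∑' k, p k * s ^ k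

/-- `n`-th functional iterate of the offspring generating function. -/
noncomputable def pgfIter (p : ℕ → ℝ) : ℕ → ℝ → ℝ
  | 0 => fun s => s
  | n + 1 => fun s => pgf p (pgfIter p n s)

lemma pgfIter_eq (p : ℕ → ℝ) (n : ℕ) (s : ℝ) : pgfIter p n s = (pgf p)^[n] s := by
  induction n with
  | zero => rfl
  | succ k ih => rw [Function.iterate_succ_apply', ← ih]; rfl

structure GoodF (f : ℝ → ℝ) (B : ℝ) : Prop where
  maps : ∀ s ∈ Set.Ico (0:ℝ) 1, f s ∈ Set.Ico (0:ℝ) 1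
  mono : ∀ s t, 0 ≤ s → s ≤ t → t < 1 → f s ≤ f t
  gap : ∃ c > 0, ∀ s ∈ Set.Ico (0:ℝ) 1, c * (1 - s)^2 ≤ f s - s
  lim : Tendsto (fun s => (1 - f s)⁻¹ - (1 - s)⁻¹) (𝓝[<] 1) (𝓝 B)

noncomputable def rr (k : ℕ) (s : ℝ) : ℝ := ∑ i ∈ Finset.range k, ∑ l ∈ Finset.range i, s ^ l

lemma rr_eq (k : ℕ) (s : ℝ) : s ^ k = 1 - k * (1 - s) + (1 - s)^2 * rr k s := by
  unfold rr
  induction k with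
  | zero => simp
  | succ k ih =>
    rw [Finset.sum_range_succ]
    have h := mul_neg_geom_sum s k
    have h2 : (1 - s)^2 * ∑ l ∈ Finset.range k, s ^ l = (1 - s) * (1 - s^k) := by rw [← h]; ring
    rw [mul_add, h2, pow_succ]
    push_cast
    linarith

lemma rr_nonneg (k : ℕ) {s : ℝ} (hs : 0 ≤ s) : 0 ≤ rr k s :=
  Finset.sum_nonneg fun _ _ => Finset.sum_nonneg fun _ _ => pow_nonneg hs _

lemma rr_le (k : ℕ) {s : ℝ} (hs : 0 ≤ s) (hs1 : s ≤ 1) : rr k s ≤ rr k 1 :=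
  Finset.sum_le_sum fun _ _ => Finset.sum_le_sum fun _ _ => pow_le_pow_left₀ hs hs1 _

lemma rr_one (k : ℕ) : rr k 1 = ((k:ℝ)^2 - k) / 2 := by
  unfold rr
  induction k with
  | zero => simp
  | succ k ih => rw [Finset.sum_range_succ, ih]; simp; ring

lemma rr_ge (k : ℕ) {s : ℝ} (hs : 0 ≤ s) (hk : 2 ≤ k) : 1 ≤ rr k s := by
  unfold rr
  have h1 : ∑ l ∈ Finset.range 1, s ^ l ≤ ∑ i ∈ Finset.range k, ∑ l ∈ Finset.range i, s ^ l :=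
    Finset.single_le_sum (f := fun i => ∑ l ∈ Finset.range i, s ^ l)
      (fun _ _ => Finset.sum_nonneg fun _ _ => pow_nonneg hs _) (by simp; omega)
  simpa using h1

lemma good_pgf (p : ℕ → ℝ) (hp0 : ∀ k, 0 ≤ p k) (hp1 : ∑' k, p k = 1)
    (hmean : ∑' k : ℕ, (k : ℝ) * p k = 1) (B : ℝ) (hB : 0 < B)
    (hsq : Summable fun k : ℕ => (k : ℝ) ^ 2 * p k)
    (hvar : (∑' k : ℕ, (k : ℝ) ^ 2 * p k) - 1 = 2 * B) : GoodF (pgf p) B := by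
  have hS : Summable p := by
    by_contra h; rw [tsum_eq_zero_of_not_summable h] at hp1; norm_num at hp1
  have hM : Summable fun k : ℕ => (k : ℝ) * p k := by
    by_contra h; rw [tsum_eq_zero_of_not_summable h] at hmean; norm_num at hmean
  have hSs : ∀ s, 0 ≤ s → s ≤ 1 → Summable fun k => p k * s ^ k := fun s h0 h1 =>
    Summable.of_nonneg_of_le (fun k => mul_nonneg (hp0 k) (pow_nonneg h0 k))
      (fun k => mul_le_of_le_one_right (hp0 k) (pow_le_one₀ h0 h1)) hS
  have hR1 : Summable fun k => p k * rr k 1 := by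
    have := (hsq.sub hM).mul_left (1/2)
    refine this.congr fun k => ?_
    rw [rr_one]; ring
  have hR1v : ∑' k, p k * rr k 1 = B := by
    have h : ∀ k : ℕ, p k * rr k 1 = (1/2) * ((k:ℝ)^2 * p k - k * p k) := fun k => by
      rw [rr_one]; ring
    rw [tsum_congr h, tsum_mul_left, hsq.tsum_sub hM, hmean, hvar]; ring
  have hRs : ∀ s, 0 ≤ s → s ≤ 1 → Summable fun k => p k * rr k s := fun s h0 h1 =>
    Summable.of_nonneg_of_le (fun k => mul_nonneg (hp0 k) (rr_nonneg k h0))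
      (fun k => mul_le_mul_of_nonneg_left (rr_le k h0 h1) (hp0 k)) hR1
  have hf : ∀ s, 0 ≤ s → s ≤ 1 → pgf p s = s + (1-s)^2 * ∑' k, p k * rr k s := by
    intro s h0 h1
    have h : ∀ k : ℕ, p k * s ^ k = p k - (1-s) * (k * p k) + (1-s)^2 * (p k * rr k s) := fun k => by
      rw [rr_eq]; ring
    unfold pgf
    rw [tsum_congr h, (hS.sub (hM.mul_left _)).tsum_add ((hRs s h0 h1).mul_left _),
      hS.tsum_sub (hM.mul_left _), tsum_mul_left, tsum_mul_left, hp1, hmean]; ring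
  obtain ⟨k0, hk0, hpk⟩ : ∃ k, 2 ≤ k ∧ 0 < p k := by
    by_contra! h
    have : ∀ k, p k * rr k 1 = 0 := by
      intro k
      rcases Nat.lt_or_ge k 2 with hk | hk
      · interval_cases k <;> simp [rr]
      · rw [le_antisymm (h k hk) (hp0 k), zero_mul]
    rw [tsum_congr this, tsum_zero] at hR1v
    linarith
  have hgap : ∀ s, 0 ≤ s → s ≤ 1 → p k0 ≤ ∑' k, p k * rr k s := fun s h0 h1 => by
    calc p k0 ≤ p k0 * rr k0 s := le_mul_of_one_le_right (hp0 _) (rr_ge k0 h0 hk0)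
      _ ≤ _ := (hRs s h0 h1).le_tsum k0 fun j _ => mul_nonneg (hp0 j) (rr_nonneg j h0)
  have hRlim : Tendsto (fun s => ∑' k, p k * rr k s) (𝓝[<] 1) (𝓝 B) := by
    rw [← hR1v]
    refine tendsto_tsum_of_dominated_convergence hR1 ?_ ?_
    · intro k
      have : Continuous fun s => p k * rr k s := by unfold rr; fun_prop
      exact (this.tendsto 1).mono_left nhdsWithin_le_nhds
    · have h1 : ∀ᶠ s : ℝ in 𝓝[<] 1, s ∈ Set.Ioo (0:ℝ) 1 := Ioo_mem_nhdsLT (by norm_num)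
      filter_upwards [h1] with s hs k
      rw [Real.norm_of_nonneg (mul_nonneg (hp0 k) (rr_nonneg k hs.1.le))]
      exact mul_le_mul_of_nonneg_left (rr_le k hs.1.le hs.2.le) (hp0 k)
  have hlt : ∀ s ∈ Set.Ico (0:ℝ) 1, pgf p s < 1 := by
    intro s hs
    rw [← hp1]
    refine Summable.tsum_lt_tsum (i := k0) (fun k => mul_le_of_le_one_right (hp0 k) (pow_le_one₀ hs.1 hs.2.le)) ?_ (hSs s hs.1 hs.2.le) hS
    exact mul_lt_of_lt_one_right hpk (pow_lt_one₀ hs.1 hs.2 (by omega))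
  refine ⟨fun s hs => ⟨tsum_nonneg fun k => mul_nonneg (hp0 k) (pow_nonneg hs.1 k), hlt s hs⟩, ?_, ⟨p k0, hpk, ?_⟩, ?_⟩
  · intro s t h0 hst ht
    exact (hSs s h0 (hst.trans ht.le)).tsum_le_tsum (fun k => mul_le_mul_of_nonneg_left (pow_le_pow_left₀ h0 hst k) (hp0 k)) (hSs t (h0.trans hst) ht.le)
  · intro s hs
    rw [hf s hs.1 hs.2.le]
    nlinarith [hgap s hs.1 hs.2.le, sq_nonneg (1-s)]
  · have hid : Tendsto (fun s : ℝ => s) (𝓝[<] 1) (𝓝 1) := tendsto_id.mono_left nhdsWithin_le_nhds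
    have hl : Tendsto (fun s => (∑' k, p k * rr k s) / (1 - (1-s) * ∑' k, p k * rr k s)) (𝓝[<] 1) (𝓝 (B / (1 - (1-1) * B))) :=
      hRlim.div (((tendsto_const_nhds.sub hid).mul hRlim).const_sub 1) (by norm_num)
    simp only [sub_self, zero_mul, sub_zero, div_one] at hl
    refine hl.congr' ?_
    have h1 : ∀ᶠ s : ℝ in 𝓝[<] 1, s ∈ Set.Ioo (0:ℝ) 1 := Ioo_mem_nhdsLT (by norm_num)
    filter_upwards [h1] with s hs
    have h2 := hlt s ⟨hs.1.le, hs.2⟩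
    have h3 : 1 - pgf p s ≠ 0 := by linarith
    have h4 : 1 - s ≠ 0 := by linarith [hs.2]
    have h5 := hf s hs.1.le hs.2.le
    have h6 : 1 - pgf p s = (1-s) * (1 - (1-s) * ∑' k, p k * rr k s) := by rw [h5]; ring
    have h7 : (1 - (1-s) * ∑' k, p k * rr k s) ≠ 0 := by
      intro h; rw [h, mul_zero] at h6; exact h3 h6
    rw [h6]
    generalize (∑' k, p k * rr k s) = R at *
    obtain ⟨D, hD⟩ : ∃ D, D = 1 - (1-s) * R := ⟨_, rfl⟩
    have hR : R = (1 - D) / (1-s) := by rw [hD]; field_simp; ring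
    rw [← hD] at h7 ⊢
    rw [hR]
    field_simp

namespace GoodF
variable {f : ℝ → ℝ} {B : ℝ}

lemma it_maps (h : GoodF f B) (n : ℕ) : ∀ s ∈ Set.Ico (0:ℝ) 1, f^[n] s ∈ Set.Ico (0:ℝ) 1 := by
  induction n with
  | zero => intro s hs; simpa using hs
  | succ n ih => intro s hs; rw [Function.iterate_succ_apply']; exact h.maps _ (ih s hs)

lemma it_mono (h : GoodF f B) (n : ℕ) {s t : ℝ} (h0 : 0 ≤ s) (hst : s ≤ t) (ht : t < 1) :
    f^[n] s ≤ f^[n] t := by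
  induction n with
  | zero => simpa using hst
  | succ n ih =>
    rw [Function.iterate_succ_apply', Function.iterate_succ_apply']
    exact h.mono _ _ (h.it_maps n s ⟨h0, hst.trans_lt ht⟩).1 ih (h.it_maps n t ⟨h0.trans hst, ht⟩).2

lemma zero_mem : (0:ℝ) ∈ Set.Ico (0:ℝ) 1 := ⟨le_rfl, one_pos⟩

lemma q_tendsto (h : GoodF f B) : Tendsto (fun n => f^[n] 0) atTop (𝓝 1) := by
  obtain ⟨c, hc, hgap⟩ := h.gap
  have hmem := fun n => h.it_maps n 0 zero_mem
  have hstep : ∀ n, c * (1 - f^[n] 0)^2 ≤ f^[n+1] 0 - f^[n] 0 := fun n => by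
    rw [Function.iterate_succ_apply']; exact hgap _ (hmem n)
  have hmono : Monotone (fun n => f^[n] 0) := monotone_nat_of_le_succ fun n => by
    have := hstep n
    have : 0 ≤ c * (1 - f^[n] 0)^2 := by positivity
    linarith
  have hbdd : BddAbove (Set.range (fun n => f^[n] 0)) := ⟨1, by rintro _ ⟨n, rfl⟩; exact (hmem n).2.le⟩
  have hl := tendsto_atTop_ciSup hmono hbdd
  set L := ⨆ n, f^[n] 0
  have h1 := (hl.const_sub 1).pow 2 |>.const_mul c
  have h2 := (hl.comp (tendsto_add_atTop_nat 1)).sub hl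
  have h3 := le_of_tendsto_of_tendsto' h1 h2 hstep
  have h4 : (1 - L)^2 = 0 := by
    have : (1-L)^2 ≤ 0 := by
      by_contra! hh
      have := mul_pos hc hh
      linarith
    exact le_antisymm this (sq_nonneg _)
  have h5 : L = 1 := by have := pow_eq_zero_iff (two_ne_zero) |>.1 h4; linarith
  rwa [h5] at hl

noncomputable def tt (f : ℝ → ℝ) (n : ℕ) : ℝ := (1 - f^[n] 0)⁻¹

lemma tt_ge (h : GoodF f B) (n : ℕ) : 1 ≤ tt f n := by
  have := h.it_maps n 0 zero_mem
  unfold tt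
  exact (one_le_inv₀ (by linarith [this.2])).2 (by linarith [this.1])

lemma tt_step (h : GoodF f B) : Tendsto (fun n => tt f (n+1) - tt f n) atTop (𝓝 B) := by
  have h1 : Tendsto (fun n => f^[n] 0) atTop (𝓝[<] 1) :=
    tendsto_nhdsWithin_iff.2 ⟨h.q_tendsto, Eventually.of_forall fun n => (h.it_maps n 0 zero_mem).2⟩
  refine (h.lim.comp h1).congr fun n => ?_
  simp only [Function.comp, tt, Function.iterate_succ_apply']

/-- uniform linear growth -/
lemma tt_lin (h : GoodF f B) {ε : ℝ} (hε : 0 < ε) :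
    ∃ A, 0 ≤ A ∧ ∀ m k : ℕ, |tt f (m+k) - tt f m - k * B| ≤ A + ε * k := by
  set d : ℕ → ℝ := fun n => |tt f (n+1) - tt f n - B| with hd
  have hd0 : Tendsto d atTop (𝓝 0) := by
    have := (h.tt_step.sub_const B).abs
    simpa using this
  obtain ⟨N, hN⟩ := eventually_atTop.1 (hd0.eventually (ge_mem_nhds hε))
  have hdn : ∀ n, 0 ≤ d n := fun n => abs_nonneg _
  refine ⟨∑ i ∈ Finset.range N, d i, Finset.sum_nonneg fun i _ => hdn i, fun m k => ?_⟩
  have h1 : |tt f (m+k) - tt f m - k * B| ≤ ∑ i ∈ Finset.range k, d (m+i) := by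
    induction k with
    | zero => simp
    | succ k ih =>
      rw [Finset.sum_range_succ]
      have : tt f (m+(k+1)) - tt f m - ((k+1:ℕ):ℝ) * B
        = (tt f (m+k) - tt f m - k * B) + (tt f (m+k+1) - tt f (m+k) - B) := by
        push_cast; rw [← add_assoc]; ring
      rw [this]
      exact (abs_add_le _ _).trans (add_le_add ih le_rfl)
  refine h1.trans ?_
  have h2 : ∀ i, d i ≤ (if i < N then d i else 0) + ε := fun i => by
    split_ifs with hi
    · linarith
    · linarith [hN i (not_lt.1 hi)]
  calc ∑ i ∈ Finset.range k, d (m+i) ≤ ∑ i ∈ Finset.range k, ((if m+i < N then d (m+i) else 0) + ε) :=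
        Finset.sum_le_sum fun i _ => h2 _
    _ = ∑ i ∈ Finset.range k, (if m+i < N then d (m+i) else 0) + ε * k := by
        rw [Finset.sum_add_distrib]; simp [mul_comm]
    _ ≤ _ := by
        gcongr
        have h3 : ∑ i ∈ Finset.range k, (if m+i < N then d (m+i) else 0)
          = ∑ j ∈ Finset.Ico m (m+k), (if j < N then d j else 0) := by
          rw [Finset.sum_Ico_eq_sum_range]; simp
        rw [h3, ← Finset.sum_filter]
        refine Finset.sum_le_sum_of_subset_of_nonneg ?_ fun i _ _ => hdn i
        intro i hi
        simp at hi ⊢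
        exact hi.2.2

lemma key (h : GoodF f B) (hB : 0 < B) {ε : ℝ} (hε : 0 < ε) :
    ∃ A, 0 ≤ A ∧ ∀ m : ℕ, ∀ s ∈ Set.Ico (0:ℝ) 1,
      |(1 - f^[m] s)⁻¹ - tt f m - (1 - s)⁻¹| ≤ A + ε * (1 - s)⁻¹ := by
  obtain ⟨η, hη, hη1, hη2⟩ : ∃ η, 0 < η ∧ η ≤ B/2 ∧ η * 4 ≤ ε * B :=
    ⟨min (B/2) (ε * B / 4), by positivity, min_le_left _ _, by
      have := min_le_right (B/2) (ε * B / 4); linarith⟩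
  obtain ⟨A, hA, hAl⟩ := h.tt_lin hη
  refine ⟨(1 + B + 2 * A + 2 * η) + ε * A, by positivity, fun m s hs => ?_⟩
  have hex : ∃ n, s < f^[n] 0 := (h.q_tendsto.eventually (lt_mem_nhds hs.2)).exists
  classical
  obtain ⟨k, hk1, hk2⟩ : ∃ k, f^[k] 0 ≤ s ∧ s < f^[k+1] 0 := by
    have hn := Nat.find_spec hex
    rcases hfe : Nat.find hex with _ | k
    · rw [hfe] at hn; simp at hn; linarith [hs.1]
    · refine ⟨k, ?_, by rwa [hfe] at hn⟩
      have := Nat.find_min hex (m := k) (by omega)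
      linarith
  have hinv : ∀ a b : ℝ, a ≤ b → b < 1 → (1-a)⁻¹ ≤ (1-b)⁻¹ := fun a b hab hb =>
    inv_anti₀ (by linarith) (by linarith)
  have e1 : tt f k ≤ (1-s)⁻¹ := hinv _ _ hk1 hs.2
  have e2 : (1-s)⁻¹ ≤ tt f (k+1) := hinv _ _ hk2.le (h.it_maps (k+1) 0 zero_mem).2
  have e3 : tt f (m+k) ≤ (1 - f^[m] s)⁻¹ := by
    unfold tt
    rw [Function.iterate_add_apply]
    exact hinv _ _ (h.it_mono m (h.it_maps k 0 zero_mem).1 hk1 hs.2) (h.it_maps m s hs).2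
  have e4 : (1 - f^[m] s)⁻¹ ≤ tt f (m+(k+1)) := by
    unfold tt
    rw [Function.iterate_add_apply]
    exact hinv _ _ (h.it_mono m hs.1 hk2.le (h.it_maps _ 0 zero_mem).2) (h.it_maps m _ (h.it_maps _ 0 zero_mem)).2
  have b1 := abs_le.1 (hAl m k)
  have b2 := abs_le.1 (hAl m (k+1))
  have b3 := abs_le.1 (hAl 0 k)
  have b4 := abs_le.1 (hAl 0 (k+1))
  have t0 : tt f 0 = 1 := by simp [tt]
  rw [zero_add, t0] at b3 b4
  push_cast at b2 b4
  have hT : (k:ℝ) * (B/2) ≤ (1-s)⁻¹ + A := by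
    have : (k:ℝ) * η ≤ k * (B/2) := by gcongr
    nlinarith [b3.1]
  have hk' : 2 * η * k ≤ ε * (1-s)⁻¹ + ε * A := by
    have : 2 * η * k ≤ ε * (k * (B/2)) := by
      have : (0:ℝ) ≤ k := by positivity
      nlinarith
    have := mul_le_mul_of_nonneg_left hT hε.le
    linarith
  rw [abs_le]
  constructor <;> nlinarith [b1.1, b1.2, b2.1, b2.2, b3.1, b3.2, b4.1, b4.2]

/-- asymptotics of tt -/
lemma tt_asymp (h : GoodF f B) (ψ : ℕ → ℝ) (hψ : Tendsto ψ atTop atTop) (k : ℕ → ℕ) (y : ℝ)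
    (hk : Tendsto (fun n => (k n : ℝ) / ψ n) atTop (𝓝 y)) :
    Tendsto (fun n => tt f (k n) / ψ n) atTop (𝓝 (B * y)) := by
  have h0 : Tendsto (fun n => (tt f (k n) - k n * B) / ψ n) atTop (𝓝 0) := by
    rw [Metric.tendsto_nhds]
    intro ε hε
    have hy : 0 < |y| + 2 := by positivity
    obtain ⟨A, hA, hAl⟩ := h.tt_lin (ε := ε / 2 / (|y| + 2)) (by positivity)
    have hkb : ∀ᶠ n in atTop, (k n : ℝ) / ψ n < |y| + 2 :=
      hk.eventually (gt_mem_nhds (by linarith [le_abs_self y]))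
    filter_upwards [hkb, hψ.eventually_gt_atTop 0, hψ.eventually_gt_atTop ((A+1) / (ε/2))] with n h1 h2 h3
    have := hAl 0 (k n)
    rw [zero_add, show tt f 0 = 1 by simp [tt]] at this
    rw [dist_zero_right, norm_div, Real.norm_of_nonneg h2.le, div_lt_iff₀ h2, Real.norm_eq_abs]
    have h4 : |tt f (k n) - k n * B| ≤ (A + 1) + ε / 2 / (|y| + 2) * k n := by
      rw [abs_le] at *; constructor <;> linarith [this.1, this.2]
    rw [div_lt_iff₀ h2] at h1
    rw [div_lt_iff₀ (by positivity)] at h3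
    have h5 : ε / 2 / (|y| + 2) * k n ≤ ε / 2 / (|y| + 2) * ((|y| + 2) * ψ n) := by gcongr
    have h6 : ε / 2 / (|y| + 2) * ((|y| + 2) * ψ n) = ε / 2 * ψ n := by field_simp
    linarith
  have := h0.add (hk.const_mul B)
  rw [zero_add] at this
  refine this.congr fun n => ?_
  ring

lemma key_asymp (h : GoodF f B) (hB : 0 < B) (ψ : ℕ → ℝ) (hψ : Tendsto ψ atTop atTop) (m : ℕ → ℕ)
    (w : ℕ → ℝ) (hw : ∀ n, w n ∈ Set.Ico (0:ℝ) 1) (y : ℝ)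
    (hy : Tendsto (fun n => (1 - w n)⁻¹ / ψ n) atTop (𝓝 y)) :
    Tendsto (fun n => ((1 - f^[m n] (w n))⁻¹ - tt f (m n)) / ψ n) atTop (𝓝 y) := by
  have h0 : Tendsto (fun n => ((1 - f^[m n] (w n))⁻¹ - tt f (m n) - (1 - w n)⁻¹) / ψ n) atTop (𝓝 0) := by
    rw [Metric.tendsto_nhds]
    intro ε hε
    have hy' : 0 < |y| + 2 := by positivity
    obtain ⟨A, hA, hAl⟩ := h.key hB (ε := ε / 2 / (|y| + 2)) (by positivity)
    have hkb : ∀ᶠ n in atTop, (1 - w n)⁻¹ / ψ n < |y| + 2 :=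
      hy.eventually (gt_mem_nhds (by linarith [le_abs_self y]))
    filter_upwards [hkb, hψ.eventually_gt_atTop 0, hψ.eventually_gt_atTop (A / (ε/2))] with n h1 h2 h3
    have h4 := hAl (m n) (w n) (hw n)
    rw [dist_zero_right, norm_div, Real.norm_of_nonneg h2.le, div_lt_iff₀ h2, Real.norm_eq_abs]
    rw [div_lt_iff₀ h2] at h1
    rw [div_lt_iff₀ (by positivity)] at h3
    have h5 : ε / 2 / (|y| + 2) * (1 - w n)⁻¹ ≤ ε / 2 / (|y| + 2) * ((|y| + 2) * ψ n) := by gcongr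
    have h6 : ε / 2 / (|y| + 2) * ((|y| + 2) * ψ n) = ε / 2 * ψ n := by field_simp
    linarith
  have := h0.add hy
  rw [zero_add] at this
  refine this.congr fun n => ?_
  ring

lemma main_asymp (h : GoodF f B) (hB : 0 < B) (ψ : ℕ → ℝ) (hψ : Tendsto ψ atTop atTop)
    (hψo : Tendsto (fun n : ℕ => ψ n / n) atTop (𝓝 0)) (m : ℕ → ℕ)
    (hm : Tendsto (fun n : ℕ => (m n : ℝ) / n) atTop (𝓝 1))
    (w : ℕ → ℝ) (hw : ∀ n, w n ∈ Set.Ico (0:ℝ) 1) (y : ℝ)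
    (hy : Tendsto (fun n => (1 - w n)⁻¹ / ψ n) atTop (𝓝 (B * y))) :
    Tendsto (fun n : ℕ => (B * n^2 / ψ n) * (f^[m n] (w n) - f^[m n] 0)) atTop (𝓝 y) := by
  have h1 := h.key_asymp hB ψ hψ m w hw _ hy
  have h2 := h.tt_asymp (fun n => (n:ℝ)) tendsto_natCast_atTop_atTop m 1 hm
  rw [mul_one] at h2
  have h3 : Tendsto (fun n : ℕ => (1 - f^[m n] (w n))⁻¹ / n) atTop (𝓝 B) := by
    have := h2.add (h1.mul hψo)
    rw [mul_zero, add_zero] at this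
    refine this.congr' ?_
    filter_upwards [hψ.eventually_gt_atTop 0] with n hn
    generalize (1 - f^[m n] (w n))⁻¹ = X
    field_simp
    ring
  have h4 := (h1.const_mul B).div (h2.mul h3) (by positivity)
  have h5 : B * (B * y) / (B * B) = y := by field_simp
  rw [h5] at h4
  refine h4.congr' ?_
  filter_upwards [hψ.eventually_gt_atTop 0, eventually_gt_atTop 0] with n hn hn0
  have a1 : 1 - f^[m n] (w n) ≠ 0 := by linarith [(h.it_maps (m n) _ (hw n)).2]
  have a2 : 1 - f^[m n] 0 ≠ 0 := by linarith [(h.it_maps (m n) _ zero_mem).2]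
  simp only [tt, Pi.div_apply]
  field_simp
  ring
end GoodF

lemma wF_int {Ω : Type*} [MeasurableSpace Ω] {μ : Measure Ω} {w V : Ω → ℝ}
    (hwi : Integrable w μ) (hV : ∀ᵐ ω ∂μ, V ω ∈ Set.Icc (0:ℝ) 1) (hVm : Measurable V)
    {F : ℝ → ℝ} (hF : Continuous F) : Integrable (fun ω => w ω * F (V ω)) μ := by
  obtain ⟨C, hC⟩ := isCompact_Icc.exists_bound_of_continuousOn (hF.continuousOn (s := Set.Icc (0:ℝ) 1))
  refine Integrable.mono' (hwi.norm.const_mul C) (hwi.aestronglyMeasurable.mul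
    (hF.measurable.comp hVm).aestronglyMeasurable) ?_
  filter_upwards [hV] with ω h
  rw [norm_mul, mul_comm]
  exact mul_le_mul_of_nonneg_right (hC _ h) (norm_nonneg _)

lemma wF_close {Ω : Type*} [MeasurableSpace Ω] {μ : Measure Ω} {w V : Ω → ℝ}
    (hwi : Integrable w μ) (hw0 : ∀ᵐ ω ∂μ, 0 ≤ w ω)
    (hV : ∀ᵐ ω ∂μ, V ω ∈ Set.Icc (0:ℝ) 1) (hVm : Measurable V)
    {F G : ℝ → ℝ} (hF : Continuous F) (hG : Continuous G) {ε : ℝ}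
    (hFG : ∀ v ∈ Set.Icc (0:ℝ) 1, |G v - F v| ≤ ε) :
    |∫ ω, w ω * G (V ω) ∂μ - ∫ ω, w ω * F (V ω) ∂μ| ≤ ε * ∫ ω, w ω ∂μ := by
  rw [← integral_sub (wF_int hwi hV hVm hG) (wF_int hwi hV hVm hF), ← integral_const_mul]
  rw [← Real.norm_eq_abs]
  refine norm_integral_le_of_norm_le (hwi.const_mul ε) ?_
  filter_upwards [hV, hw0] with ω h h0
  rw [← mul_sub, norm_mul, Real.norm_of_nonneg h0, mul_comm]
  exact mul_le_mul_of_nonneg_right (hFG _ h) h0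

lemma wP_eq {Ω : Type*} [MeasurableSpace Ω] {μ : Measure Ω} {w V : Ω → ℝ}
    (hwi : Integrable w μ) (hV : ∀ᵐ ω ∂μ, V ω ∈ Set.Icc (0:ℝ) 1) (hVm : Measurable V)
    (P : Polynomial ℝ) : ∫ ω, w ω * P.eval (V ω) ∂μ
      = ∑ i ∈ Finset.range (P.natDegree + 1), P.coeff i * ∫ ω, w ω * V ω ^ i ∂μ := by
  have : ∀ ω, w ω * P.eval (V ω) = ∑ i ∈ Finset.range (P.natDegree + 1), P.coeff i * (w ω * V ω ^ i) := by
    intro ω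
    rw [Polynomial.eval_eq_sum_range, Finset.mul_sum]
    exact Finset.sum_congr rfl fun i _ => by ring
  simp_rw [this]
  rw [integral_finsetSum _ fun i _ => (wF_int hwi hV hVm (continuous_pow i)).const_mul _]
  simp_rw [integral_const_mul]

lemma weier {Ω Ω' : Type*} [MeasurableSpace Ω] [MeasurableSpace Ω'] {μ : Measure Ω} {ν : Measure Ω'}
    {w V : ℕ → Ω → ℝ} {w' V' : Ω' → ℝ}
    (hwi : ∀ n, Integrable (w n) μ) (hw0 : ∀ n, ∀ᵐ ω ∂μ, 0 ≤ w n ω)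
    (hV : ∀ n, ∀ᵐ ω ∂μ, V n ω ∈ Set.Icc (0:ℝ) 1) (hVm : ∀ n, Measurable (V n))
    (hwi' : Integrable w' ν) (hw0' : ∀ᵐ ω ∂ν, 0 ≤ w' ω)
    (hV' : ∀ᵐ ω ∂ν, V' ω ∈ Set.Icc (0:ℝ) 1) (hVm' : Measurable V')
    (hmom : ∀ k : ℕ, Tendsto (fun n => ∫ ω, w n ω * V n ω ^ k ∂μ) atTop (𝓝 (∫ ω, w' ω * V' ω ^ k ∂ν)))
    {F : ℝ → ℝ} (hF : Continuous F) :
    Tendsto (fun n => ∫ ω, w n ω * F (V n ω) ∂μ) atTop (𝓝 (∫ ω, w' ω * F (V' ω) ∂ν)) := by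
  rw [Metric.tendsto_nhds]
  intro ε hε
  have h0 := hmom 0
  simp only [pow_zero, mul_one] at h0
  set M := ∫ ω, w' ω ∂ν with hM
  have hM0 : 0 ≤ M := integral_nonneg_of_ae hw0'
  obtain ⟨P, hP⟩ := exists_polynomial_near_of_continuousOn 0 1 F hF.continuousOn (ε / (3 * (M + 1))) (by positivity)
  have hP' : ∀ v ∈ Set.Icc (0:ℝ) 1, |P.eval v - F v| ≤ ε / (3 * (M + 1)) := fun v hv => (hP v hv).le
  have hlim : Tendsto (fun n => ∫ ω, w n ω * P.eval (V n ω) ∂μ) atTop (𝓝 (∫ ω, w' ω * P.eval (V' ω) ∂ν)) := by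
    rw [wP_eq hwi' hV' hVm']
    simp_rw [fun n => wP_eq (hwi n) (hV n) (hVm n) P]
    exact tendsto_finsetSum _ fun i _ => (hmom i).const_mul _
  have e1 : ∀ᶠ n in atTop, ∫ ω, w n ω ∂μ < M + 1 := h0.eventually (gt_mem_nhds (by linarith))
  have e2 := (Metric.tendsto_nhds.1 hlim) (ε/3) (by positivity)
  filter_upwards [e1, e2] with n h1 h2
  have c1 := wF_close (hwi n) (hw0 n) (hV n) (hVm n) hF P.continuous hP'
  have c2 := wF_close hwi' hw0' hV' hVm' hF P.continuous hP'
  have hq : ε / (3 * (M + 1)) * (M+1) = ε / 3 := by field_simp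
  have c3 : ε / (3 * (M + 1)) * ∫ ω, w n ω ∂μ ≤ ε / 3 := by
    rw [← hq]; gcongr
  have c4 : ε / (3 * (M + 1)) * M ≤ ε / 3 := by
    rw [← hq]; gcongr; linarith
  rw [Real.dist_eq] at h2 ⊢
  rw [abs_le] at c1 c2
  rw [abs_lt] at h2 ⊢
  constructor <;> linarith [c1.1, c1.2, c2.1, c2.2, h2.1, h2.2]

noncomputable def clampf (a b v : ℝ) : ℝ := max 0 (min 1 ((v - a) / (b - a)))

lemma clampf_nonneg (a b v : ℝ) : 0 ≤ clampf a b v := le_max_left _ _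
lemma clampf_le_one (a b v : ℝ) : clampf a b v ≤ 1 := max_le zero_le_one (min_le_left _ _)
lemma clampf_zero {a b v : ℝ} (hab : a < b) (hv : v ≤ a) : clampf a b v = 0 := by
  unfold clampf
  have : (v - a) / (b - a) ≤ 0 := div_nonpos_of_nonpos_of_nonneg (by linarith) (by linarith)
  exact max_eq_left ((min_le_right _ _).trans this)
lemma clampf_one {a b v : ℝ} (hab : a < b) (hv : b ≤ v) : clampf a b v = 1 := by
  unfold clampf
  have : 1 ≤ (v - a) / (b - a) := by rw [le_div_iff₀ (by linarith)]; linarith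
  rw [min_eq_left this]; norm_num
lemma clampf_cont (a b : ℝ) : Continuous (clampf a b) := by unfold clampf; fun_prop

lemma clampf_mul {a b : ℝ} (ha : 0 < a) (hab : a < b) (v : ℝ) :
    v * (clampf a b v / max v a) = clampf a b v := by
  rcases le_or_gt v a with h | h
  · rw [clampf_zero hab h]; simp
  · rw [max_eq_left h.le]; exact mul_div_cancel₀ _ (ha.trans h).ne'

lemma karamata {Ω : Type*} [MeasurableSpace Ω] {μ : Measure Ω} [IsProbabilityMeasure μ]
    (c : ℕ → ℝ) (hc : ∀ n, 0 ≤ c n) (A : ℕ → Set Ω) (hA : ∀ n, MeasurableSet (A n))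
    (W : ℕ → Ω → ℝ) (hW : ∀ n ω, 0 ≤ W n ω) (hWm : ∀ n, Measurable (W n))
    (g : ℝ → ℝ) (hg : Continuous g) (hg0 : ∀ y, 0 < y → 0 ≤ g y)
    (hgi : IntegrableOn (fun y => g y * Real.exp (-y)) (Set.Ioi 0))
    (hmom : ∀ k : ℕ, Tendsto (fun n => c n * ∫ ω, (A n).indicator (fun _ => (1:ℝ)) ω * Real.exp (-W n ω) ^ (k+1) ∂μ) atTop
      (𝓝 (∫ y in Set.Ioi (0:ℝ), g y * Real.exp (-y) ^ (k+1)))) :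
    Tendsto (fun n => c n * (μ (A n ∩ {ω | W n ω ≤ 1})).toReal) atTop (𝓝 (∫ y in (0:ℝ)..1, g y)) := by
  -- convergence on clamp functions
  have hVmem : ∀ n ω, Real.exp (-W n ω) ∈ Set.Icc (0:ℝ) 1 := fun n ω =>
    ⟨(Real.exp_pos _).le, Real.exp_le_one_iff.2 (by linarith [hW n ω])⟩
  have hVm : ∀ n, Measurable fun ω => Real.exp (-W n ω) := fun n => (hWm n).neg.exp
  have hind0 : ∀ n ω, 0 ≤ (A n).indicator (fun _ => (1:ℝ)) ω := fun n ω => Set.indicator_nonneg (fun _ _ => zero_le_one) _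
  have hind : ∀ n, Integrable ((A n).indicator (fun _ => (1:ℝ))) μ := fun n => (integrable_const _).indicator (hA n)
  have hclamp : ∀ a b : ℝ, 0 < a → a < b → Tendsto (fun n => c n * ∫ ω, (A n).indicator (fun _ => (1:ℝ)) ω * clampf a b (Real.exp (-W n ω)) ∂μ) atTop
      (𝓝 (∫ y in Set.Ioi (0:ℝ), g y * clampf a b (Real.exp (-y)))) := by
    intro a b ha hab
    have := weier (μ := μ) (ν := volume.restrict (Set.Ioi (0:ℝ)))
      (w := fun n ω => c n * ((A n).indicator (fun _ => (1:ℝ)) ω * Real.exp (-W n ω)))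
      (V := fun n ω => Real.exp (-W n ω)) (w' := fun y => g y * Real.exp (-y)) (V' := fun y => Real.exp (-y))
      (fun n => (wF_int (hind n) (ae_of_all _ (hVmem n)) (hVm n) continuous_id).const_mul _)
      (fun n => ae_of_all _ fun ω => mul_nonneg (hc n) (mul_nonneg (hind0 n ω) (hVmem n ω).1))
      (fun n => ae_of_all _ (hVmem n)) hVm hgi
      ((ae_restrict_iff' measurableSet_Ioi).2 (ae_of_all _ fun y hy => mul_nonneg (hg0 y hy) (Real.exp_pos _).le))
      ((ae_restrict_iff' measurableSet_Ioi).2 (ae_of_all _ fun y hy => ⟨(Real.exp_pos _).le, Real.exp_le_one_iff.2 (by linarith [Set.mem_Ioi.1 hy])⟩))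
      (by fun_prop) ?_ (F := fun v => clampf a b v / max v a) ?_
    · simp_rw [mul_assoc, clampf_mul ha hab] at this
      simpa only [integral_const_mul] using this
    · intro k
      have e1 : ∀ n, ∫ ω, c n * ((A n).indicator (fun _ => (1:ℝ)) ω * Real.exp (-W n ω)) * Real.exp (-W n ω) ^ k ∂μ
          = c n * ∫ ω, (A n).indicator (fun _ => (1:ℝ)) ω * Real.exp (-W n ω) ^ (k+1) ∂μ := fun n => by
        rw [← integral_const_mul]
        exact integral_congr_ae (ae_of_all _ fun ω => by simp only; ring)
      have e2 : ∫ y in Set.Ioi (0:ℝ), g y * Real.exp (-y) * Real.exp (-y) ^ k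
          = ∫ y in Set.Ioi (0:ℝ), g y * Real.exp (-y) ^ (k+1) :=
        integral_congr_ae (ae_of_all _ fun ω => by simp only; ring)
      simp only [e1, e2]
      exact hmom k
    · exact (clampf_cont a b).div (by fun_prop) fun v => (lt_max_of_lt_right ha).ne'
  set e := Real.exp (-1) with he
  have he0 : 0 < e := Real.exp_pos _
  have hmeasS : ∀ n, MeasurableSet (A n ∩ {ω | W n ω ≤ 1}) := fun n => (hA n).inter (measurableSet_le (hWm n) measurable_const)
  have hprob : ∀ n, (μ (A n ∩ {ω | W n ω ≤ 1})).toReal = ∫ ω, (A n ∩ {ω | W n ω ≤ 1}).indicator (fun _ => (1:ℝ)) ω ∂μ := fun n => by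
    rw [integral_indicator_const _ (hmeasS n)]; simp [Measure.real]
  have hci : ∀ a b n, Integrable (fun ω => (A n).indicator (fun _ => (1:ℝ)) ω * clampf a b (Real.exp (-W n ω))) μ := fun a b n =>
    wF_int (hind n) (ae_of_all _ (hVmem n)) (hVm n) (clampf_cont a b)
  have hii : ∀ n, Integrable ((A n ∩ {ω | W n ω ≤ 1}).indicator (fun _ => (1:ℝ))) μ := fun n => (integrable_const _).indicator (hmeasS n)
  have hup : ∀ a, 0 < a → a < e → ∀ n, c n * (μ (A n ∩ {ω | W n ω ≤ 1})).toReal ≤ c n * ∫ ω, (A n).indicator (fun _ => (1:ℝ)) ω * clampf a e (Real.exp (-W n ω)) ∂μ := by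
    intro a ha hae n
    rw [hprob]
    refine mul_le_mul_of_nonneg_left (integral_mono (hii n) (hci a e n) fun ω => ?_) (hc n)
    by_cases h1 : ω ∈ A n
    · by_cases h2 : W n ω ≤ 1
      · simp only [Set.indicator, Set.mem_inter_iff, h1, h2, Set.mem_ofPred_eq, and_self, if_true]
        rw [clampf_one hae (Real.exp_le_exp.2 (by linarith))]; norm_num
      · simp [Set.indicator, h1, h2, clampf_nonneg]
    · simp [Set.indicator, h1]
  have hdn : ∀ b, e < b → ∀ n, c n * ∫ ω, (A n).indicator (fun _ => (1:ℝ)) ω * clampf e b (Real.exp (-W n ω)) ∂μ ≤ c n * (μ (A n ∩ {ω | W n ω ≤ 1})).toReal := by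
    intro b heb n
    rw [hprob]
    refine mul_le_mul_of_nonneg_left (integral_mono (hci e b n) (hii n) fun ω => ?_) (hc n)
    by_cases h1 : ω ∈ A n
    · by_cases h2 : W n ω ≤ 1
      · simp [Set.indicator, h1, h2, clampf_le_one]
      · simp only [Set.indicator, Set.mem_inter_iff, h1, h2, Set.mem_ofPred_eq, and_false, if_true, if_false]
        rw [clampf_zero heb (Real.exp_le_exp.2 (by linarith))]; norm_num
    · simp [Set.indicator, h1]
  -- limits of the integrals
  have hI : ∫ y in (0:ℝ)..1, g y = ∫ y in Set.Ioi (0:ℝ), (Set.Iic (1:ℝ)).indicator g y := by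
    rw [intervalIntegral.integral_of_le zero_le_one, setIntegral_indicator measurableSet_Iic]; rfl
  have hdct : ∀ a b : ℕ → ℝ, (∀ k, e/2 ≤ a k) → (∀ k, a k < b k) → (∀ k, a k ≤ e ∧ e ≤ b k) →
      Tendsto a atTop (𝓝 e) → Tendsto b atTop (𝓝 e) →
      Tendsto (fun k => ∫ y in Set.Ioi (0:ℝ), g y * clampf (a k) (b k) (Real.exp (-y))) atTop (𝓝 (∫ y in (0:ℝ)..1, g y)) := by
    intro a b ha hab hae hta htb
    rw [hI]
    refine tendsto_integral_of_dominated_convergence (fun y => (2/e) * (g y * Real.exp (-y))) ?_ (hgi.const_mul _) ?_ ?_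
    · intro k
      exact (hg.mul ((clampf_cont _ _).comp (by fun_prop))).aestronglyMeasurable
    · intro k
      refine (ae_restrict_iff' measurableSet_Ioi).2 (ae_of_all _ fun y hy => ?_)
      have hgy := hg0 y hy
      rw [Real.norm_of_nonneg (mul_nonneg hgy (clampf_nonneg _ _ _))]
      have : clampf (a k) (b k) (Real.exp (-y)) ≤ (2/e) * Real.exp (-y) := by
        rcases le_or_gt (Real.exp (-y)) (a k) with h | h
        · rw [clampf_zero (hab k) h]; positivity
        · refine (clampf_le_one _ _ _).trans ?_
          rw [div_mul_eq_mul_div, le_div_iff₀ he0]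
          linarith [ha k]
      nlinarith
    · have hne : ∀ᵐ y ∂(volume.restrict (Set.Ioi (0:ℝ))), y ≠ 1 := by
        refine ae_restrict_of_ae ?_
        exact Measure.ae_ne volume 1
      filter_upwards [hne] with y hy
      rcases lt_or_gt_of_ne hy with h | h
      · have : e < Real.exp (-y) := Real.exp_lt_exp.2 (by linarith)
        refine tendsto_const_nhds.congr' ?_
        filter_upwards [htb.eventually (gt_mem_nhds this)] with k hk
        rw [clampf_one (hab k) hk.le, Set.indicator_of_mem (by exact h.le), mul_one]
      · have : Real.exp (-y) < e := Real.exp_lt_exp.2 (by linarith)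
        refine tendsto_const_nhds.congr' ?_
        filter_upwards [hta.eventually (lt_mem_nhds this)] with k hk
        rw [clampf_zero (hab k) hk.le, Set.indicator_of_notMem (by simpa using h), mul_zero]
  have hinv : Tendsto (fun k : ℕ => (1:ℝ) / ((k:ℝ) + 1)) atTop (𝓝 0) := tendsto_one_div_add_atTop_nhds_zero_nat
  have hpos : ∀ k : ℕ, 0 < (1:ℝ) / ((k:ℝ) + 1) := fun k => by positivity
  have hle : ∀ k : ℕ, (1:ℝ) / ((k:ℝ) + 1) ≤ 1 := fun k => by
    rw [div_le_one (by positivity)]; linarith [(Nat.cast_nonneg k : (0:ℝ) ≤ k)]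
  have hU := hdct (fun k => e - e/2 * (1 / ((k:ℝ)+1))) (fun _ => e)
    (fun k => by have := hle k; nlinarith) (fun k => by have := mul_pos (half_pos he0) (hpos k); linarith)
    (fun k => ⟨by have := mul_pos (half_pos he0) (hpos k); linarith, le_rfl⟩)
    (by simpa using (hinv.const_mul (e/2)).const_sub e) tendsto_const_nhds
  have hD := hdct (fun _ => e) (fun k => e + (1 / ((k:ℝ)+1)))
    (fun k => by linarith) (fun k => by linarith [hpos k])
    (fun k => ⟨le_rfl, by linarith [hpos k]⟩)
    tendsto_const_nhds (by simpa using hinv.const_add e)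
  refine tendsto_order.2 ⟨fun l hl => ?_, fun u hu => ?_⟩
  · obtain ⟨k, hk⟩ := (hD.eventually (lt_mem_nhds hl)).exists
    filter_upwards [(hclamp e (e + (1 / ((k:ℝ)+1))) he0 (by linarith [hpos k])).eventually (lt_mem_nhds hk)] with n hn
    exact hn.trans_le (hdn _ (by linarith [hpos k]) n)
  · obtain ⟨k, hk⟩ := (hU.eventually (gt_mem_nhds hu)).exists
    have hlt : e - e/2 * (1 / ((k:ℝ)+1)) < e := by have := mul_pos (half_pos he0) (hpos k); linarith
    have h0 : 0 < e - e/2 * (1 / ((k:ℝ)+1)) := by have := hle k; nlinarith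
    filter_upwards [(hclamp _ e h0 hlt).eventually (gt_mem_nhds hk)] with n hn
    exact (hup _ h0 hlt n).trans_lt hn

lemma gamma_int (j : ℕ) {r : ℝ} (hr : 0 < r) :
    ∫ y in Set.Ioi (0:ℝ), y ^ j * Real.exp (-(r * y)) = (1 / r) ^ (j + 1) * (j.factorial : ℝ) := by
  have := Real.integral_rpow_mul_exp_neg_mul_Ioi (a := (j:ℝ) + 1) (by positivity) hr
  simp only [add_sub_cancel_right, Real.rpow_natCast, Real.Gamma_nat_eq_factorial] at this
  rw [this]
  norm_cast

lemma u_asymp {B : ℝ} (hB : 0 < B) {ψ : ℕ → ℝ} (hψ : Tendsto ψ atTop atTop) {l : ℝ} (hl : 0 < l) :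
    Tendsto (fun n => (1 - Real.exp (-(l / (B * ψ n))))⁻¹ / ψ n) atTop (𝓝 (B * (1 / l))) := by
  have hd : HasDerivAt (fun h : ℝ => 1 - Real.exp (-h)) 1 0 := by
    have := ((hasDerivAt_neg (0:ℝ)).exp).const_sub 1
    simpa using this
  have h1 := hd.tendsto_slope_zero
  have hh : Tendsto (fun n => l / (B * ψ n)) atTop (𝓝 0) :=
    (hψ.const_mul_atTop hB).const_div_atTop l
  have hh' : Tendsto (fun n => l / (B * ψ n)) atTop (𝓝[≠] 0) := by
    refine tendsto_nhdsWithin_iff.2 ⟨hh, ?_⟩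
    filter_upwards [hψ.eventually_gt_atTop 0] with n hn
    have : 0 < l / (B * ψ n) := by positivity
    exact this.ne'
  have h2 := ((h1.comp hh').inv₀ one_ne_zero).const_mul (B * (1/l))
  rw [inv_one, mul_one] at h2
  refine h2.congr' ?_
  filter_upwards [hψ.eventually_gt_atTop 0] with n hn
  simp only [Function.comp, zero_add, neg_zero, Real.exp_zero, sub_self, sub_zero, smul_eq_mul, mul_inv, inv_inv]
  generalize (1 - Real.exp (-(l / (B * ψ n))))⁻¹ = X
  field_simp

lemma mk_asymp {ψ : ℕ → ℝ} (hψ : Tendsto ψ atTop atTop)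
    (hψo : Tendsto (fun n : ℕ => ψ n / n) atTop (𝓝 0)) {x : ℝ} (hx : 0 < x) :
    Tendsto (fun n : ℕ => ((n - ⌊x * ψ n⌋₊ : ℕ) : ℝ) / n) atTop (𝓝 1) ∧
    Tendsto (fun n : ℕ => ((n - (n - ⌊x * ψ n⌋₊) : ℕ) : ℝ) / ψ n) atTop (𝓝 x) := by
  have h1 : Tendsto (fun n : ℕ => ((⌊x * ψ n⌋₊ : ℕ) : ℝ) / ψ n) atTop (𝓝 x) :=
    (tendsto_nat_floor_mul_div_atTop hx.le).comp hψ
  have h2 : Tendsto (fun n : ℕ => ((⌊x * ψ n⌋₊ : ℕ) : ℝ) / n) atTop (𝓝 0) := by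
    have := h1.mul hψo
    rw [mul_zero] at this
    refine this.congr' ?_
    filter_upwards [hψ.eventually_gt_atTop 0] with n hn
    field_simp
  have h3 : ∀ᶠ n : ℕ in atTop, ⌊x * ψ n⌋₊ ≤ n := by
    filter_upwards [h2.eventually (gt_mem_nhds one_pos), eventually_gt_atTop 0] with n hn h0
    have : (0:ℝ) < n := by exact_mod_cast h0
    rw [div_lt_one this] at hn
    exact_mod_cast hn.le
  constructor
  · have := h2.const_sub 1
    rw [sub_zero] at this
    refine this.congr' ?_
    filter_upwards [h3, eventually_gt_atTop 0] with n hn h0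
    have : (0:ℝ) < n := by exact_mod_cast h0
    rw [Nat.cast_sub hn]
    field_simp
  · refine h1.congr' ?_
    filter_upwards [h3] with n hn
    rw [Nat.sub_sub_self hn]

lemma joint_asymp {f : ℝ → ℝ} {B : ℝ} (h : GoodF f B) (hB : 0 < B) (ψ : ℕ → ℝ) (hψ : Tendsto ψ atTop atTop)
    (hψ1 : ∀ n, 1 ≤ ψ n)
    (hψo : Tendsto (fun n : ℕ => ψ n / n) atTop (𝓝 0)) {x : ℝ} (hx : 0 < x) (m k : ℕ → ℕ)
    (hm : Tendsto (fun n : ℕ => (m n : ℝ) / n) atTop (𝓝 1))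
    (hk : Tendsto (fun n : ℕ => (k n : ℝ) / ψ n) atTop (𝓝 x)) {l : ℝ} (hl : 0 < l)
    {s : ℝ} (hs0 : 0 ≤ s) (hs1 : s ≤ 1) :
    Tendsto (fun n : ℕ => (B * n^2 / ψ n) *
      (f^[m n] (f^[k n] 0 + s * (f^[k n] (Real.exp (-(l / (B * ψ n)))) - f^[k n] 0))
        - f^[m n] (f^[k n] 0))) atTop (𝓝 (x / (1 - s * (1 / (1 + l * x))) - x)) := by
  have hu : ∀ n, Real.exp (-(l / (B * ψ n))) ∈ Set.Ico (0:ℝ) 1 := fun n => by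
    have : 0 < l / (B * ψ n) := by have := hψ1 n; positivity
    exact ⟨(Real.exp_pos _).le, (by rw [← Real.exp_zero]; exact Real.exp_lt_exp.2 (by linarith))⟩
  have ha := fun n => h.it_maps (k n) 0 GoodF.zero_mem
  have hb := fun n => h.it_maps (k n) _ (hu n)
  have hab := fun n => h.it_mono (k n) le_rfl (hu n).1 (hu n).2
  have hw : ∀ n, f^[k n] 0 + s * (f^[k n] (Real.exp (-(l / (B * ψ n)))) - f^[k n] 0) ∈ Set.Ico (0:ℝ) 1 := by
    intro n
    have h1 := ha n; have h2 := hb n; have h3 := hab n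
    constructor
    · nlinarith [h1.1]
    · nlinarith [h2.2]
  have t1 := h.tt_asymp ψ hψ k x hk
  have t2 := (h.key_asymp hB ψ hψ k _ hu _ (u_asymp hB hψ hl)).add t1
  have i1 := t1.inv₀ (by positivity)
  have i2 := t2.inv₀ (by positivity)
  have i3 := (i1.const_mul (1 - s)).add (i2.const_mul s)
  have hlx : 0 < 1 + l * x := by positivity
  have hq : 0 < 1 - s * (1 / (1 + l * x)) := by
    have : s * (1 / (1 + l * x)) < 1 := by
      rw [mul_one_div, div_lt_one hlx]; nlinarith [mul_pos hl hx]
    linarith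
  have hval : ((1 - s) * (B * x)⁻¹ + s * (B * (1 / l) + B * x)⁻¹) = (1 - s * (1 / (1 + l * x))) / (B * x) := by
    field_simp
    ring
  rw [hval] at i3
  have i4 := i3.inv₀ (by positivity)
  rw [inv_div, mul_div_assoc] at i4
  have hy : Tendsto (fun n => (1 - (f^[k n] 0 + s * (f^[k n] (Real.exp (-(l / (B * ψ n)))) - f^[k n] 0)))⁻¹ / ψ n) atTop
      (𝓝 (B * (x / (1 - s * (1 / (1 + l * x)))))) := by
    refine i4.congr fun n => ?_
    rw [GoodF.tt, ← add_div, sub_add_cancel, inv_div, inv_div, div_inv_eq_mul, div_inv_eq_mul]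
    generalize f^[k n] (Real.exp (-(l / (B * ψ n)))) = b
    generalize f^[k n] 0 = a
    rw [div_eq_mul_inv _ (ψ n), ← mul_inv]
    congr 1
    ring
  have r1 := h.main_asymp hB ψ hψ hψo m hm _ hw _ hy
  have r2 := h.main_asymp hB ψ hψ hψo m hm _ ha _ t1
  refine (r1.sub r2).congr fun n => ?_
  ring

noncomputable def spikef (j : ℕ) (v : ℝ) : ℝ := max 0 (1 - 2^(j+1) * |v - (1/2)^j|)

lemma spikef_cont (j : ℕ) : Continuous (spikef j) := by unfold spikef; fun_prop

lemma spikef_val (j i : ℕ) : spikef j ((1/2)^i) = if i = j then 1 else 0 := by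
  unfold spikef
  split_ifs with hij
  · subst hij; simp
  · apply max_eq_left
    have h2 : (2:ℝ)^(j+1) * (1/2)^j = 2 := by
      rw [pow_succ, mul_right_comm, ← mul_pow]; norm_num
    have hp : (0:ℝ) < 2^(j+1) := by positivity
    rcases Nat.lt_or_gt_of_ne hij with h | h
    · have h3 : ((1:ℝ)/2)^j * 2 ≤ (1/2)^i := by
        have : ((1:ℝ)/2)^j ≤ (1/2)^(i+1) := pow_le_pow_of_le_one (by norm_num) (by norm_num) h
        rw [pow_succ] at this; linarith
      have h4 : ((1:ℝ)/2)^j ≤ |(1/2)^i - (1/2)^j| := le_trans (by linarith) (le_abs_self _)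
      nlinarith
    · have h3 : ((1:ℝ)/2)^i ≤ (1/2)^j * (1/2) := by
        rw [← pow_succ]; exact pow_le_pow_of_le_one (by norm_num) (by norm_num) h
      have h4 : ((1:ℝ)/2)^j * (1/2) ≤ |(1/2)^i - (1/2)^j| := le_trans (by linarith) (neg_le_abs _)
      nlinarith

section core
variable {p : ℕ → ℝ} {B : ℝ} {Ω : Type*} [MeasurableSpace Ω] {μ : Measure Ω} [IsProbabilityMeasure μ]

lemma pow_zero_ind (u : ℝ) (z : ℕ) (S : ℝ) :
    S * u ^ z - S * 0 ^ z = ({z : ℕ | 0 < z}.indicator (fun _ => (1:ℝ)) z) * (S * u ^ z) := by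
  rcases Nat.eq_zero_or_pos z with h | h
  · subst h; simp
  · rw [Set.indicator_of_mem (by exact h), zero_pow h.ne']; ring

lemma int_su {X Y : Ω → ℕ} (hX : Measurable X) (hY : Measurable Y) {s u : ℝ}
    (hs : s ∈ Set.Icc (0:ℝ) 1) (hu : u ∈ Set.Icc (0:ℝ) 1) :
    Integrable (fun ω => s ^ X ω * u ^ Y ω) μ := by
  refine Integrable.mono' (integrable_const (1:ℝ)) ?_ (ae_of_all _ fun ω => ?_)
  · exact (((measurable_of_countable fun z : ℕ => s ^ z).comp hX).mul
      ((measurable_of_countable fun z : ℕ => u ^ z).comp hY)).aestronglyMeasurable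
  · rw [Real.norm_of_nonneg (mul_nonneg (pow_nonneg hs.1 _) (pow_nonneg hu.1 _))]
    exact mul_le_one₀ (pow_le_one₀ hs.1 hs.2) (pow_nonneg hu.1 _) (pow_le_one₀ hu.1 hu.2)

lemma exp_W {B ψ : ℝ} (k z : ℕ) :
    Real.exp (-((z:ℝ) / (B * ψ))) ^ (k+1) = Real.exp (-(((k+1 : ℕ):ℝ) / (B * ψ))) ^ z := by
  rw [← Real.exp_nat_mul, ← Real.exp_nat_mul]
  congr 1
  ring

lemma core_den (h : GoodF (pgf p) B) (hB : 0 < B)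
    (Z : ℕ → Ω → ℕ) (hZm : ∀ n, Measurable (Z n))
    (hZ : ∀ n, ∀ s ∈ Set.Icc (0 : ℝ) 1, ∫ ω, s ^ Z n ω ∂μ = pgfIter p n s)
    (ψ : ℕ → ℝ) (hψ : Tendsto ψ atTop atTop) (hψ1 : ∀ n, 1 ≤ ψ n)
    (hψo : Tendsto (fun n : ℕ => ψ n / n) atTop (𝓝 0)) :
    Tendsto (fun n : ℕ => (B * n^2 / ψ n) * (μ ({ω | 0 < Z n ω} ∩ {ω | (Z n ω : ℝ) / (B * ψ n) ≤ 1})).toReal)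
      atTop (𝓝 1) := by
  have hBψ : ∀ n, 0 < B * ψ n := fun n => mul_pos hB (one_pos.trans_le (hψ1 n))
  have hZr : ∀ n, Measurable fun ω => (Z n ω : ℝ) := fun n => (measurable_of_countable _).comp (hZm n)
  have key := karamata (μ := μ) (fun n : ℕ => B * n^2 / ψ n)
    (fun n => by have := hψ1 n; positivity)
    (fun n => {ω | 0 < Z n ω}) (fun n => measurableSet_lt measurable_const (hZm n))
    (fun n ω => (Z n ω : ℝ) / (B * ψ n)) (fun n ω => div_nonneg (Nat.cast_nonneg _) (hBψ n).le)
    (fun n => (hZr n).div_const _) (fun _ => 1) continuous_const (fun _ _ => zero_le_one)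
    (by simpa using integrableOn_exp_neg_Ioi 0) ?_
  · simpa using key
  intro k
  have hl : (0:ℝ) < ((k+1:ℕ):ℝ) := by positivity
  have hlim : ∫ y in Set.Ioi (0:ℝ), 1 * Real.exp (-y) ^ (k+1) = 1 / ((k+1:ℕ):ℝ) := by
    have := gamma_int 0 hl
    simp only [pow_zero, Nat.factorial_zero, Nat.cast_one, mul_one, zero_add, pow_one] at this
    rw [← this]
    refine integral_congr_ae (ae_of_all _ fun y => ?_)
    simp only
    rw [← Real.exp_nat_mul]; simp
  rw [hlim]
  have hu : ∀ n, Real.exp (-(((k+1:ℕ):ℝ) / (B * ψ n))) ∈ Set.Ico (0:ℝ) 1 := fun n => by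
    have : 0 < ((k+1:ℕ):ℝ) / (B * ψ n) := div_pos hl (hBψ n)
    exact ⟨(Real.exp_pos _).le, (by rw [← Real.exp_zero]; exact Real.exp_lt_exp.2 (by linarith))⟩
  have hone : Tendsto (fun n : ℕ => (n : ℝ) / n) atTop (𝓝 1) := by
    refine tendsto_const_nhds.congr' ?_
    filter_upwards [eventually_gt_atTop 0] with n hn
    have : (n:ℝ) ≠ 0 := by exact_mod_cast hn.ne'
    rw [div_self this]
  refine (h.main_asymp hB ψ hψ hψo (fun n => n) hone _ hu _ (u_asymp hB hψ hl)).congr fun n => ?_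
  congr 1
  rw [← pgfIter_eq, ← pgfIter_eq, ← hZ n _ ⟨(hu n).1, (hu n).2.le⟩, ← hZ n 0 ⟨le_rfl, zero_le_one⟩]
  have i1 := int_su (μ := μ) (hZm n) (hZm n) (s := 1) ⟨zero_le_one, le_rfl⟩ ⟨(hu n).1, (hu n).2.le⟩
  have i2 := int_su (μ := μ) (hZm n) (hZm n) (s := 1) (u := 0) ⟨zero_le_one, le_rfl⟩ ⟨le_rfl, zero_le_one⟩
  simp only [one_pow, one_mul] at i1 i2
  rw [← integral_sub i1 i2]
  refine integral_congr_ae (ae_of_all _ fun ω => ?_)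
  simp only
  rw [exp_W]
  have := pow_zero_ind (Real.exp (-(((k+1:ℕ):ℝ) / (B * ψ n)))) (Z n ω) 1
  simp only [one_mul] at this
  exact this

lemma core_num (h : GoodF (pgf p) B) (hB : 0 < B)
    (Z : ℕ → Ω → ℕ) (hZm : ∀ n, Measurable (Z n))
    (Zred : ℕ → ℕ → Ω → ℕ) (hZredm : ∀ m n, Measurable (Zred m n))
    (hjoint : ∀ m n, m ≤ n → ∀ s ∈ Set.Icc (0 : ℝ) 1, ∀ u ∈ Set.Icc (0 : ℝ) 1,
      ∫ ω, s ^ Zred m n ω * u ^ Z n ω ∂μ =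
        pgfIter p m (pgfIter p (n - m) 0 +
          s * (pgfIter p (n - m) u - pgfIter p (n - m) 0)))
    (ψ : ℕ → ℝ) (hψ : Tendsto ψ atTop atTop) (hψ1 : ∀ n, 1 ≤ ψ n)
    (hψo : Tendsto (fun n : ℕ => ψ n / n) atTop (𝓝 0)) (x : ℝ) (hx : 0 < x) (j : ℕ) :
    Tendsto (fun n : ℕ => (B * n^2 / ψ n) *
      (μ (({ω | Zred (n - ⌊x * ψ n⌋₊) n ω = j + 1} ∩ {ω | 0 < Z n ω}) ∩ {ω | (Z n ω : ℝ) / (B * ψ n) ≤ 1})).toReal)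
      atTop (𝓝 (x / (j.factorial : ℝ) * ∫ z in (0 : ℝ)..(1 / x), z ^ j * Real.exp (-z))) := by
  have hBψ : ∀ n, 0 < B * ψ n := fun n => mul_pos hB (one_pos.trans_le (hψ1 n))
  have hc : ∀ n : ℕ, 0 ≤ B * n^2 / ψ n := fun n => by have := hψ1 n; positivity
  have hZr : ∀ n, Measurable fun ω => (Z n ω : ℝ) := fun n => (measurable_of_countable _).comp (hZm n)
  have hA : ∀ n, MeasurableSet {ω | 0 < Z n ω} := fun n => measurableSet_lt measurable_const (hZm n)
  have hR : ∀ n, MeasurableSet {ω | Zred (n - ⌊x * ψ n⌋₊) n ω = j + 1} := fun n =>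
    measurableSet_eq_fun (hZredm _ _) measurable_const
  obtain ⟨hm, hk⟩ := mk_asymp hψ hψo hx
  have hgint : ∫ y in (0:ℝ)..1, (1/x)^j / (j.factorial : ℝ) * (y ^ j * Real.exp (-(1/x * y)))
      = x / (j.factorial : ℝ) * ∫ z in (0 : ℝ)..(1 / x), z ^ j * Real.exp (-z) := by
    have := intervalIntegral.mul_integral_comp_mul_left (a := 0) (b := 1) (c := 1/x) (f := fun z => z ^ j * Real.exp (-z))
    rw [mul_zero, mul_one] at this
    rw [← this]
    simp_rw [mul_pow, mul_assoc]
    rw [intervalIntegral.integral_const_mul, intervalIntegral.integral_const_mul]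
    field_simp
  rw [← hgint]
  have hgm : ∀ k : ℕ, ∫ y in Set.Ioi (0:ℝ), (1/x)^j / (j.factorial : ℝ) * (y ^ j * Real.exp (-(1/x * y))) * Real.exp (-y) ^ (k+1)
      = x * (1 / (1 + ((k+1:ℕ):ℝ) * x)) ^ (j+1) := by
    intro k
    have hr : 0 < 1/x + ((k+1:ℕ):ℝ) := by positivity
    have e : ∀ y : ℝ, (1/x)^j / (j.factorial : ℝ) * (y ^ j * Real.exp (-(1/x * y))) * Real.exp (-y) ^ (k+1)
      = (1/x)^j / (j.factorial : ℝ) * (y ^ j * Real.exp (-((1/x + ((k+1:ℕ):ℝ)) * y))) := fun y => by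
      rw [← Real.exp_nat_mul, mul_assoc, mul_assoc, ← Real.exp_add]
      congr 4
      ring
    simp_rw [e]
    rw [integral_const_mul, gamma_int j hr]
    have e2 : 1 / (1/x + ((k+1:ℕ):ℝ)) = x * (1 / (1 + ((k+1:ℕ):ℝ) * x)) := by field_simp
    have hf : (j.factorial : ℝ) ≠ 0 := by positivity
    rw [e2, mul_pow, pow_succ x, one_div x, inv_pow]
    field_simp
  refine karamata (μ := μ) (fun n : ℕ => B * n^2 / ψ n) hc
    (fun n => {ω | Zred (n - ⌊x * ψ n⌋₊) n ω = j + 1} ∩ {ω | 0 < Z n ω}) (fun n => (hR n).inter (hA n))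
    (fun n ω => (Z n ω : ℝ) / (B * ψ n)) (fun n ω => div_nonneg (Nat.cast_nonneg _) (hBψ n).le)
    (fun n => (hZr n).div_const _)
    (fun y => (1/x)^j / (j.factorial : ℝ) * (y ^ j * Real.exp (-(1/x * y)))) (by fun_prop)
    (fun y hy => by positivity) ?_ ?_
  · have := hgm 0
    simp only [zero_add, pow_one] at this
    refine Integrable.of_integral_ne_zero ?_
    rw [this]
    positivity
  intro k
  rw [hgm k]
  set l : ℝ := ((k+1:ℕ):ℝ) with hldef
  have hl : 0 < l := by positivity
  set q : ℝ := 1 / (1 + l * x) with hq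
  have hq0 : 0 < q := by positivity
  have hq1 : q < 1 := by
    rw [hq, div_lt_one (by positivity)]; nlinarith [mul_pos hl hx]
  have hu : ∀ n, Real.exp (-(l / (B * ψ n))) ∈ Set.Ico (0:ℝ) 1 := fun n => by
    have : 0 < l / (B * ψ n) := div_pos hl (hBψ n)
    exact ⟨(Real.exp_pos _).le, (by rw [← Real.exp_zero]; exact Real.exp_lt_exp.2 (by linarith))⟩
  have hinit := fun n => (integrable_const (μ := μ) (1:ℝ)).indicator (hA n)
  have hEm : ∀ n ω, Real.exp (-(l / (B * ψ n))) ^ Z n ω ∈ Set.Icc (0:ℝ) 1 := fun n ω =>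
    ⟨pow_nonneg (hu n).1 _, pow_le_one₀ (hu n).1 (hu n).2.le⟩
  have hEmeas : ∀ n, Measurable fun ω => Real.exp (-(l / (B * ψ n))) ^ Z n ω := fun n =>
    (measurable_of_countable fun z : ℕ => Real.exp (-(l / (B * ψ n))) ^ z).comp (hZm n)
  have hgeo : ∀ r : ℝ, 0 ≤ r → r < 1 → Summable fun i : ℕ => x * r ^ (i+1) := fun r h0 h1 => by
    simp_rw [pow_succ]
    exact ((summable_geometric_of_lt_one h0 h1).mul_right r).mul_left x
  have hcnt : ∀ F : ℕ → ℝ, Summable F → (∀ i, 0 ≤ F i) → Integrable F Measure.count ∧ ∫ i, F i ∂Measure.count = ∑' i, F i := by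
    intro F hF hF0
    have hi : Integrable F Measure.count := integrable_count_iff.2 hF.norm
    refine ⟨hi, ?_⟩
    rw [integral_countable hi]
    simp [Measure.real]
  have hVm' : Measurable fun i : ℕ => ((1:ℝ)/2)^(i+1) := measurable_of_countable _
  have hV' : ∀ i : ℕ, ((1:ℝ)/2)^i ∈ Set.Icc (0:ℝ) 1 := fun i =>
    ⟨by positivity, pow_le_one₀ (by norm_num) (by norm_num)⟩
  have hw' := hcnt (fun i => x * q^(i+1)) (hgeo q hq0.le hq1) (fun i => by positivity)
  have W := weier (μ := μ) (ν := (Measure.count : Measure ℕ))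
    (w := fun n ω => (B * n^2 / ψ n) * ({ω | 0 < Z n ω}.indicator (fun _ => (1:ℝ)) ω * Real.exp (-(l / (B * ψ n))) ^ Z n ω))
    (V := fun n ω => ((1:ℝ)/2)^(Zred (n - ⌊x * ψ n⌋₊) n ω))
    (w' := fun i => x * q^(i+1)) (V' := fun i => ((1:ℝ)/2)^(i+1))
    (fun n => (wF_int (hinit n) (ae_of_all _ (hEm n)) (hEmeas n) continuous_id).const_mul _)
    (fun n => ae_of_all _ fun ω => mul_nonneg (hc n) (mul_nonneg (Set.indicator_nonneg (fun _ _ => zero_le_one) _) (hEm n ω).1))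
    (fun n => ae_of_all _ fun ω => hV' _)
    (fun n => (measurable_of_countable fun z : ℕ => ((1:ℝ)/2)^z).comp (hZredm _ _))
    hw'.1 (ae_of_all _ fun i => by positivity) (ae_of_all _ fun i => hV' _) hVm' ?_ (spikef_cont (j+1))
  · have e1 : ∫ i : ℕ, x * q^(i+1) * spikef (j+1) (((1:ℝ)/2)^(i+1)) ∂Measure.count = x * q^(j+1) := by
      have : ∀ i : ℕ, x * q^(i+1) * spikef (j+1) (((1:ℝ)/2)^(i+1)) = if i = j then x * q^(j+1) else 0 := fun i => by
        rw [spikef_val]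
        by_cases hij : i = j
        · subst hij; simp
        · simp [hij]
      simp_rw [this]
      rw [(hcnt _ (summable_of_ne_finset_zero (s := {j}) (fun i hi => by simp at hi; simp [hi])) (fun i => by split_ifs <;> positivity)).2]
      simp
    rw [e1] at W
    refine W.congr fun n => ?_
    rw [← integral_const_mul]
    refine integral_congr_ae (ae_of_all _ fun ω => ?_)
    simp only
    rw [spikef_val, exp_W]
    by_cases h1 : Zred (n - ⌊x * ψ n⌋₊) n ω = j + 1 <;> by_cases h2 : 0 < Z n ω <;>
      simp [Set.indicator, h1, h2, hldef]
  · intro i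
    have hs := hV' i
    set s : ℝ := (1/2)^i with hsdef
    have hqs : q * s < 1 := by nlinarith [hs.1, hs.2]
    have hqs0 : 0 ≤ q * s := mul_nonneg hq0.le hs.1
    have e1 : ∫ a : ℕ, x * q^(a+1) * (((1:ℝ)/2)^(a+1))^i ∂Measure.count = x / (1 - s * q) - x := by
      have : ∀ a : ℕ, x * q^(a+1) * (((1:ℝ)/2)^(a+1))^i = x * (q * s)^(a+1) := fun a => by
        rw [mul_pow, hsdef, ← pow_mul, ← pow_mul, mul_comm i, mul_assoc]
      simp_rw [this]
      rw [(hcnt _ (hgeo _ hqs0 hqs) (fun a => by positivity)).2]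
      simp_rw [pow_succ]
      rw [tsum_mul_left, tsum_mul_right, tsum_geometric_of_lt_one hqs0 hqs, mul_comm s q]
      have : 1 - q * s ≠ 0 := by linarith
      field_simp
      ring
    rw [e1]
    refine (joint_asymp h hB ψ hψ hψ1 hψo hx _ _ hm hk hl hs.1 hs.2).congr fun n => ?_
    have hmn : n - ⌊x * ψ n⌋₊ ≤ n := Nat.sub_le _ _
    have j1 := hjoint _ n hmn s hs _ ⟨(hu n).1, (hu n).2.le⟩
    have j2 := hjoint _ n hmn s hs 0 ⟨le_rfl, zero_le_one⟩
    rw [sub_self, mul_zero, add_zero] at j2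
    simp only [pgfIter_eq] at j1 j2
    rw [← j1, ← j2, ← integral_sub (int_su (hZredm _ _) (hZm n) hs ⟨(hu n).1, (hu n).2.le⟩)
      (int_su (hZredm _ _) (hZm n) hs ⟨le_rfl, zero_le_one⟩), ← integral_const_mul]
    refine integral_congr_ae (ae_of_all _ fun ω => ?_)
    simp only
    rw [pow_zero_ind, hsdef, ← pow_mul, ← pow_mul, mul_comm i]
    simp only [Set.indicator, Set.mem_ofPred_eq]
    ring

end core

theorem reduced_process_conditional_limit    (p : ℕ → ℝ) (hp0 : ∀ k, 0 ≤ p k) (hp1 : ∑' k, p k = 1)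
    (hmean : ∑' k : ℕ, (k : ℝ) * p k = 1) (B : ℝ) (hB : 0 < B)
    (hsq : Summable fun k : ℕ => (k : ℝ) ^ 2 * p k)
    (hvar : (∑' k : ℕ, (k : ℝ) ^ 2 * p k) - 1 = 2 * B)
    (hgcd : ∀ d : ℕ, (∀ k, 0 < p k → d ∣ k) → d = 1)
    {Ω : Type*} [MeasurableSpace Ω] (μ : Measure Ω) [IsProbabilityMeasure μ]
    (Z : ℕ → Ω → ℕ) (hZm : ∀ n, Measurable (Z n))
    (hZ : ∀ n, ∀ s ∈ Set.Icc (0 : ℝ) 1, ∫ ω, s ^ Z n ω ∂μ = pgfIter p n s)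
    (Zred : ℕ → ℕ → Ω → ℕ) (hZredm : ∀ m n, Measurable (Zred m n))
    (hjoint : ∀ m n, m ≤ n → ∀ s ∈ Set.Icc (0 : ℝ) 1, ∀ u ∈ Set.Icc (0 : ℝ) 1,
      ∫ ω, s ^ Zred m n ω * u ^ Z n ω ∂μ =
        pgfIter p m (pgfIter p (n - m) 0 +
          s * (pgfIter p (n - m) u - pgfIter p (n - m) 0)))
    (φ : ℕ → ℝ) (hφ : Tendsto φ atTop atTop)
    (hφo : (fun n : ℕ => φ n) =o[atTop] fun n : ℕ => (n : ℝ)) :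
    ∀ x : ℝ, 0 < x → ∀ j : ℕ, 1 ≤ j →
      Tendsto (fun n : ℕ =>
          (μ ({ω | Zred (n - ⌊x * φ n⌋₊) n ω = j} ∩
              {ω | 0 < Z n ω ∧ (Z n ω : ℝ) ≤ B * φ n})).toReal /
            (μ {ω | 0 < Z n ω ∧ (Z n ω : ℝ) ≤ B * φ n}).toReal)
        atTop
        (𝓝 (x / (Nat.factorial (j - 1) : ℝ) * ∫ z in (0 : ℝ)..(1 / x), z ^ (j - 1) * Real.exp (-z))) := by
  intro x hx j hj
  have h := good_pgf p hp0 hp1 hmean B hB hsq hvar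
  obtain ⟨j, rfl⟩ : ∃ i, j = i + 1 := ⟨j - 1, by omega⟩
  rw [Nat.add_sub_cancel]
  set ψ : ℕ → ℝ := fun n => max (φ n) 1 with hψdef
  have hev : ∀ᶠ n in atTop, ψ n = φ n := by
    filter_upwards [hφ.eventually_ge_atTop 1] with n hn
    exact max_eq_left hn
  have hψ : Tendsto ψ atTop atTop := hφ.congr' (hev.mono fun n hn => hn.symm)
  have hψ1 : ∀ n, 1 ≤ ψ n := fun n => le_max_right _ _
  have hψo : Tendsto (fun n : ℕ => ψ n / n) atTop (𝓝 0) :=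
    hφo.tendsto_div_nhds_zero.congr' (hev.mono fun n hn => by simp only [hn])
  have hnum := core_num (μ := μ) h hB Z hZm Zred hZredm hjoint ψ hψ hψ1 hψo x hx j
  have hden := core_den (μ := μ) h hB Z hZm hZ ψ hψ hψ1 hψo
  have hlim := hnum.div hden one_ne_zero
  rw [div_one] at hlim
  refine hlim.congr' ?_
  filter_upwards [hev, eventually_gt_atTop 0] with n hn h0
  have hφ0 : 0 < φ n := by rw [← hn]; exact one_pos.trans_le (hψ1 n)
  have hset : {ω | 0 < Z n ω} ∩ {ω | (Z n ω : ℝ) / (B * ψ n) ≤ 1} = {ω | 0 < Z n ω ∧ (Z n ω : ℝ) ≤ B * φ n} := by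
    ext ω
    simp only [Set.mem_inter_iff, Set.mem_ofPred_eq, hn, div_le_one (mul_pos hB hφ0)]
  have hc : B * (n:ℝ)^2 / φ n ≠ 0 := by
    have : (0:ℝ) < n := by exact_mod_cast h0
    positivity
  simp only [Pi.div_apply]
  rw [Set.inter_assoc, hset, hn]
  exact mul_div_mul_left _ _ hc
end

section
/- Under the conditions of Theorem 1 (critical aperiodic GW process with variance 2B ∈ (0,∞), φ(n)→∞, φ(n)=o(n)), for every x > 0 and s ∈ [0,1]: lim_{n→∞} E[s^{Z(n-⌊xφ(n)⌋, n)} | 0 < Z(n) ≤ Bφ(n)] = s x (1 - e^{-(1-s)/x})/(1-s) (understood as s at s=1). -/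
open MeasureTheory Filter Topology Asymptotics Real

namespace RP

/-- second-order quotient coefficient -/
noncomputable def ck (k : ℕ) (y : ℝ) : ℝ := ∑ i ∈ Finset.range k, ∑ j ∈ Finset.range i, y ^ j

/-- second-order quotient -/
noncomputable def cf (p : ℕ → ℝ) (y : ℝ) : ℝ := ∑' k, p k * ck k y

/-- reciprocal of the distance to one -/
noncomputable def gg (y : ℝ) : ℝ := (1 - y)⁻¹

/-- increment of gg -/
noncomputable def DD (p : ℕ → ℝ) (y : ℝ) : ℝ := gg (pgf p y) - gg y

lemma ck_identity (k : ℕ) (y : ℝ) : y ^ k = 1 - k * (1 - y) + (1 - y) ^ 2 * ck k y := by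
  induction k with
  | zero => simp [ck]
  | succ k ih =>
    have h : ck (k+1) y = ck k y + ∑ j ∈ Finset.range k, y ^ j := by
      simp [ck, Finset.sum_range_succ]
    have h2 : (1 - y) * ∑ j ∈ Finset.range k, y ^ j = 1 - y ^ k := mul_neg_geom_sum y k
    rw [h, mul_add, pow_two, mul_assoc (1-y) (1-y) (∑ j ∈ Finset.range k, y ^ j), h2]
    push_cast
    rw [pow_succ]
    linear_combination ih

lemma ck_nonneg (k : ℕ) {y : ℝ} (hy : 0 ≤ y) : 0 ≤ ck k y :=
  Finset.sum_nonneg fun _ _ => Finset.sum_nonneg fun _ _ => pow_nonneg hy _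

lemma ck_le (k : ℕ) {y : ℝ} (hy : 0 ≤ y) (hy1 : y ≤ 1) : ck k y ≤ (k : ℝ) ^ 2 := by
  calc ck k y ≤ ∑ i ∈ Finset.range k, (k : ℝ) := by
        apply Finset.sum_le_sum
        intro i hi
        calc ∑ j ∈ Finset.range i, y ^ j ≤ ∑ j ∈ Finset.range i, (1 : ℝ) :=
              Finset.sum_le_sum fun j _ => pow_le_one₀ hy hy1
          _ = i := by simp
          _ ≤ k := by exact_mod_cast (Finset.mem_range.1 hi).le
    _ = (k : ℝ) ^ 2 := by simp [pow_two]

lemma ck_mono (k : ℕ) {y : ℝ} (hy : 0 ≤ y) : ck k 0 ≤ ck k y := by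
  apply Finset.sum_le_sum
  intro i _
  apply Finset.sum_le_sum
  intro j _
  gcongr

lemma ck_one (k : ℕ) : ck k 1 = ((k : ℝ) ^ 2 - k) / 2 := by
  induction k with
  | zero => simp [ck]
  | succ k ih =>
    have h : ck (k+1) 1 = ck k 1 + ∑ j ∈ Finset.range k, (1:ℝ) ^ j := by
      simp [ck, Finset.sum_range_succ]
    rw [h, ih]; simp; ring

lemma ck_cont (k : ℕ) : Continuous (ck k) := by
  unfold ck; fun_prop

section
variable {p : ℕ → ℝ} {B : ℝ}

/-- standing assumptions -/
structure Crit (p : ℕ → ℝ) (B : ℝ) : Prop where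
  hp0 : ∀ k, 0 ≤ p k
  hp1 : ∑' k, p k = 1
  hmean : ∑' k : ℕ, (k : ℝ) * p k = 1
  hB : 0 < B
  hsq : Summable fun k : ℕ => (k : ℝ) ^ 2 * p k
  hvar : (∑' k : ℕ, (k : ℝ) ^ 2 * p k) - 1 = 2 * B

lemma Crit.sp (H : Crit p B) : Summable p := by
  by_contra h
  have := H.hp1
  rw [tsum_eq_zero_of_not_summable h] at this
  norm_num at this

lemma Crit.sm (H : Crit p B) : Summable fun k : ℕ => (k : ℝ) * p k := by
  by_contra h
  have := H.hmean
  rw [tsum_eq_zero_of_not_summable h] at this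
  norm_num at this

lemma Crit.sc (H : Crit p B) {y : ℝ} (hy : 0 ≤ y) (hy1 : y ≤ 1) :
    Summable fun k : ℕ => p k * ck k y := by
  refine Summable.of_nonneg_of_le (fun k => mul_nonneg (H.hp0 k) (ck_nonneg k hy)) (fun k => ?_) H.hsq
  rw [mul_comm]
  exact mul_le_mul_of_nonneg_right (ck_le k hy hy1) (H.hp0 k)

lemma Crit.sf (H : Crit p B) {y : ℝ} (hy : 0 ≤ y) (hy1 : y ≤ 1) :
    Summable fun k : ℕ => p k * y ^ k := by
  refine Summable.of_nonneg_of_le (fun k => mul_nonneg (H.hp0 k) (pow_nonneg hy k)) (fun k => ?_) H.sp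
  exact mul_le_of_le_one_right (H.hp0 k) (pow_le_one₀ hy hy1)

lemma Crit.pgf_eq (H : Crit p B) {y : ℝ} (hy : 0 ≤ y) (hy1 : y ≤ 1) :
    pgf p y = y + (1 - y) ^ 2 * cf p y := by
  have h1 : HasSum p 1 := H.hp1 ▸ H.sp.hasSum
  have h2 : HasSum (fun k : ℕ => (k : ℝ) * p k) 1 := by
    have := H.sm.hasSum; rwa [H.hmean] at this
  have h3 := (H.sc hy hy1).hasSum
  have h4 := (h1.sub (h2.mul_left (1 - y))).add (h3.mul_left ((1 - y) ^ 2))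
  have h5 : HasSum (fun k => p k * y ^ k) (1 - (1 - y) * 1 + (1 - y) ^ 2 * cf p y) := by
    have e : (fun k => p k * y ^ k) =
        fun k : ℕ => p k - (1 - y) * ((k : ℝ) * p k) + (1 - y) ^ 2 * (p k * ck k y) := by
      ext k
      rw [ck_identity k y]; ring
    rw [e]; exact h4
  rw [pgf, h5.tsum_eq]; ring

lemma Crit.cf_nonneg (H : Crit p B) {y : ℝ} (hy : 0 ≤ y) : 0 ≤ cf p y :=
  tsum_nonneg fun k => mul_nonneg (H.hp0 k) (ck_nonneg k hy)

lemma Crit.cf_one (H : Crit p B) : cf p 1 = B := by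
  have h := (H.hsq.hasSum.sub H.sm.hasSum).mul_right (1/2)
  have h5 : HasSum (fun k => p k * ck k 1) (((∑' k : ℕ, (k : ℝ) ^ 2 * p k) - ∑' k : ℕ, (k : ℝ) * p k) * (1/2)) := by
    have e : (fun k => p k * ck k 1) =
        fun k : ℕ => ((k : ℝ) ^ 2 * p k - (k : ℝ) * p k) * (1/2) := by
      ext k
      rw [ck_one]; ring
    rw [e]; exact h
  rw [cf, h5.tsum_eq, H.hmean, H.hvar]; ring

lemma Crit.cf_zero_pos (H : Crit p B) : 0 < cf p 0 := by
  obtain ⟨k, hk2, hk⟩ : ∃ k : ℕ, 2 ≤ k ∧ p k ≠ 0 := by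
    by_contra! hcon
    have : cf p 1 = 0 := by
      rw [cf]
      have : ∀ k, p k * ck k 1 = 0 := by
        intro k
        by_cases hk : 2 ≤ k
        · simp [hcon k hk]
        · have : k = 0 ∨ k = 1 := by omega
          rcases this with rfl | rfl <;> simp [ck_one]
      simp [this]
    rw [H.cf_one] at this
    exact H.hB.ne' this
  have h1 : 0 < ck k 0 := by
    have : ∑ j ∈ Finset.range 1, (0:ℝ) ^ j ≤ ck k 0 :=
      Finset.single_le_sum (f := fun i => ∑ j ∈ Finset.range i, (0:ℝ) ^ j)
        (fun i _ => Finset.sum_nonneg fun _ _ => by positivity) (Finset.mem_range.2 (by omega))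
    simp at this; linarith
  exact (H.sc le_rfl zero_le_one).tsum_pos
    (fun i => mul_nonneg (H.hp0 i) (ck_nonneg i le_rfl)) k
    (mul_pos (lt_of_le_of_ne (H.hp0 k) hk.symm) h1)

lemma Crit.cf_ge (H : Crit p B) {y : ℝ} (hy : 0 ≤ y) (hy1 : y ≤ 1) : cf p 0 ≤ cf p y :=
  (H.sc le_rfl zero_le_one).tsum_le_tsum
    (fun k => mul_le_mul_of_nonneg_left (ck_mono k hy) (H.hp0 k)) (H.sc hy hy1)

lemma Crit.cf_tendsto (H : Crit p B) {u : ℕ → ℝ} (hu : ∀ᶠ n in atTop, 0 ≤ u n ∧ u n ≤ 1)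
    (h : Tendsto u atTop (𝓝 1)) : Tendsto (fun n => cf p (u n)) atTop (𝓝 B) := by
  rw [← H.cf_one]
  apply tendsto_tsum_of_dominated_convergence (bound := fun k : ℕ => (k : ℝ) ^ 2 * p k) H.hsq
  · intro k
    exact (((ck_cont k).tendsto 1).comp h).const_mul _
  · filter_upwards [hu] with n hn k
    rw [Real.norm_of_nonneg (mul_nonneg (H.hp0 k) (ck_nonneg k hn.1)), mul_comm]
    exact mul_le_mul_of_nonneg_right (ck_le k hn.1 hn.2) (H.hp0 k)

lemma Crit.pgf_ge (H : Crit p B) {y : ℝ} (hy : 0 ≤ y) (hy1 : y ≤ 1) : y ≤ pgf p y := by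
  rw [H.pgf_eq hy hy1]
  have := mul_nonneg (sq_nonneg (1 - y)) (H.cf_nonneg hy)
  linarith

lemma Crit.pgf_mono (H : Crit p B) {y z : ℝ} (hy : 0 ≤ y) (hyz : y ≤ z) (hz : z ≤ 1) :
    pgf p y ≤ pgf p z :=
  (H.sf hy (hyz.trans hz)).tsum_le_tsum
    (fun k => mul_le_mul_of_nonneg_left (pow_le_pow_left₀ hy hyz k) (H.hp0 k))
    (H.sf (hy.trans hyz) hz)

lemma Crit.pgf_lt (H : Crit p B) {y : ℝ} (hy : 0 ≤ y) (hy1 : y < 1) : pgf p y < 1 := by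
  obtain ⟨k, hk2, hk⟩ : ∃ k : ℕ, 1 ≤ k ∧ p k ≠ 0 := by
    by_contra! hcon
    have : ∀ k : ℕ, (k : ℝ) * p k = 0 := by
      intro k
      rcases Nat.eq_zero_or_pos k with rfl | hk
      · simp
      · simp [hcon k hk]
    have h := H.hmean
    simp [this] at h
  rw [← H.hp1]
  refine (H.sf hy hy1.le).tsum_lt_tsum (i := k) (fun j => ?_) ?_ H.sp
  · exact mul_le_of_le_one_right (H.hp0 j) (pow_le_one₀ hy hy1.le)
  · exact mul_lt_of_lt_one_right (lt_of_le_of_ne (H.hp0 k) hk.symm)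
      (pow_lt_one₀ hy hy1 (by omega))

lemma Crit.iter_mem (H : Crit p B) {y : ℝ} (hy : 0 ≤ y) (hy1 : y < 1) (n : ℕ) :
    y ≤ pgfIter p n y ∧ pgfIter p n y < 1 := by
  induction n with
  | zero => exact ⟨le_rfl, hy1⟩
  | succ n ih =>
    have h0 : 0 ≤ pgfIter p n y := hy.trans ih.1
    exact ⟨ih.1.trans (H.pgf_ge h0 ih.2.le), H.pgf_lt h0 ih.2⟩

lemma Crit.pgf_one (H : Crit p B) : pgf p 1 = 1 := by
  rw [H.pgf_eq zero_le_one le_rfl]; ring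

lemma Crit.iter_one (H : Crit p B) (n : ℕ) : pgfIter p n 1 = 1 := by
  induction n with
  | zero => rfl
  | succ n ih => show pgf p (pgfIter p n 1) = 1; rw [ih, H.pgf_one]

lemma Crit.iter_mono (H : Crit p B) {y z : ℝ} (hy : 0 ≤ y) (hyz : y ≤ z) (hz : z < 1) (n : ℕ) :
    pgfIter p n y ≤ pgfIter p n z := by
  induction n with
  | zero => exact hyz
  | succ n ih =>
    exact H.pgf_mono (hy.trans (H.iter_mem hy (hyz.trans_lt hz) n).1) ih
      (H.iter_mem (hy.trans hyz) hz n).2.le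

lemma iter_add (p : ℕ → ℝ) (m n : ℕ) (y : ℝ) :
    pgfIter p (m + n) y = pgfIter p m (pgfIter p n y) := by
  induction m with
  | zero => simp [pgfIter]
  | succ m ih => rw [Nat.succ_add]; show pgf p _ = pgf p _; rw [ih]

lemma Crit.DD_eq (H : Crit p B) {y : ℝ} (hy : 0 ≤ y) (hy1 : y < 1) :
    0 < 1 - (1 - y) * cf p y ∧ DD p y = cf p y / (1 - (1 - y) * cf p y) := by
  have h1 : 0 < 1 - y := by linarith
  have h2 : 1 - pgf p y = (1 - y) * (1 - (1 - y) * cf p y) := by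
    rw [H.pgf_eq hy hy1.le]; ring
  have h3 : 0 < 1 - pgf p y := by linarith [H.pgf_lt hy hy1]
  have h4 : 0 < 1 - (1 - y) * cf p y := by
    rw [h2] at h3; exact (pos_iff_pos_of_mul_pos h3).1 h1
  refine ⟨h4, ?_⟩
  rw [DD, gg, gg, h2]
  field_simp
  ring

lemma Crit.DD_ge (H : Crit p B) {y : ℝ} (hy : 0 ≤ y) (hy1 : y < 1) : cf p 0 ≤ DD p y := by
  obtain ⟨h, h2⟩ := H.DD_eq hy hy1
  rw [h2, le_div_iff₀ h]
  have h3 := H.cf_ge hy hy1.le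
  have h4 : 1 - (1 - y) * cf p y ≤ 1 := by
    have := mul_nonneg (sub_nonneg.2 hy1.le) (H.cf_nonneg hy); linarith
  calc _ ≤ cf p 0 * 1 := mul_le_mul_of_nonneg_left h4 H.cf_zero_pos.le
    _ ≤ _ := by linarith

lemma Crit.DD_tendsto_seq (H : Crit p B) {u : ℕ → ℝ} (hu : ∀ᶠ n in atTop, 0 ≤ u n ∧ u n < 1)
    (h : Tendsto u atTop (𝓝 1)) : Tendsto (fun n => DD p (u n)) atTop (𝓝 B) := by
  have h1 := H.cf_tendsto (hu.mono fun n hn => ⟨hn.1, hn.2.le⟩) h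
  have h2 : Tendsto (fun n => cf p (u n) / (1 - (1 - u n) * cf p (u n))) atTop
      (𝓝 (B / (1 - (1 - 1) * B))) :=
    h1.div (tendsto_const_nhds.sub ((tendsto_const_nhds.sub h).mul h1)) (by simp)
  simp only [sub_self, zero_mul, sub_zero, div_one] at h2
  refine h2.congr' ?_
  filter_upwards [hu] with n hn
  exact (H.DD_eq hn.1 hn.2).2.symm

lemma Crit.DD_near (H : Crit p B) {ε : ℝ} (hε : 0 < ε) :
    ∃ δ < (1 : ℝ), ∀ y, 0 ≤ y → δ ≤ y → y < 1 → |DD p y - B| ≤ ε := by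
  by_contra! hcon
  choose u hu0 hu1 hu2 hu3 using fun n : ℕ => hcon (1 - 1 / ((n : ℝ) + 1))
    (by have : (0:ℝ) < 1 / ((n : ℝ) + 1) := by positivity
        linarith)
  have hu : Tendsto u atTop (𝓝 1) := by
    refine tendsto_of_tendsto_of_tendsto_of_le_of_le (g := fun n : ℕ => 1 - 1 / ((n : ℝ) + 1))
      (h := fun _ => (1 : ℝ)) ?_ tendsto_const_nhds hu1 (fun n => (hu2 n).le)
    simpa using tendsto_one_div_add_atTop_nhds_zero_nat.const_sub (1 : ℝ)
  have h1 := H.DD_tendsto_seq (Eventually.of_forall fun n => ⟨hu0 n, hu2 n⟩) hu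
  obtain ⟨n, hn⟩ := (Metric.tendsto_nhds.1 h1 ε hε).exists
  exact (lt_asymm hn (hu3 n)).elim

lemma gg_iter (p : ℕ → ℝ) (n : ℕ) (y : ℝ) :
    gg (pgfIter p n y) - gg y = ∑ j ∈ Finset.range n, DD p (pgfIter p j y) := by
  have := Finset.sum_range_sub (fun j => gg (pgfIter p j y)) n
  simpa [DD, pgfIter] using this.symm

lemma Crit.gg_iter_tendsto (H : Crit p B) {y : ℕ → ℝ} {r : ℕ → ℕ} {a : ℕ → ℝ} {ρ : ℝ}
    (hy : ∀ᶠ n in atTop, 0 ≤ y n ∧ y n < 1) (hy1 : Tendsto y atTop (𝓝 1))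
    (ha : ∀ᶠ n in atTop, 0 < a n)
    (hr : Tendsto (fun n => (r n : ℝ) / a n) atTop (𝓝 ρ)) :
    Tendsto (fun n => (gg (pgfIter p (r n) (y n)) - gg (y n)) / a n) atTop (𝓝 (ρ * B)) := by
  have h1 : Tendsto (fun n => (r n : ℝ) / a n * B) atTop (𝓝 (ρ * B)) := hr.mul_const B
  have h2 : Tendsto (fun n => (gg (pgfIter p (r n) (y n)) - gg (y n)) / a n - (r n : ℝ) / a n * B)
      atTop (𝓝 0) := by
    rw [Metric.tendsto_nhds]
    intro ε hε
    have hK : ∀ᶠ n in atTop, (r n : ℝ) / a n < |ρ| + 1 :=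
      hr.eventually_lt_const (by linarith [le_abs_self ρ])
    have hK0 : 0 < |ρ| + 1 := by positivity
    obtain ⟨δ, hδ, hD⟩ := H.DD_near (ε := ε / (2 * (|ρ| + 1))) (by positivity)
    filter_upwards [hy, hy1.eventually_const_lt hδ, ha, hK] with n hn hn2 ha hK
    have h3 : |gg (pgfIter p (r n) (y n)) - gg (y n) - r n * B| ≤ r n * (ε / (2 * (|ρ| + 1))) := by
      rw [gg_iter]
      have : ∑ j ∈ Finset.range (r n), DD p (pgfIter p j (y n)) - r n * B
          = ∑ j ∈ Finset.range (r n), (DD p (pgfIter p j (y n)) - B) := by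
        simp [Finset.sum_sub_distrib]
      rw [this]
      refine (Finset.abs_sum_le_sum_abs _ _).trans ?_
      calc _ ≤ ∑ j ∈ Finset.range (r n), (ε / (2 * (|ρ| + 1))) := by
            apply Finset.sum_le_sum
            intro j _
            have := H.iter_mem hn.1 hn.2 j
            exact hD _ (hn.1.trans this.1) (hn2.le.trans this.1) this.2
        _ = _ := by simp
    rw [Real.dist_eq, sub_zero]
    have h4 : (gg (pgfIter p (r n) (y n)) - gg (y n)) / a n - (r n : ℝ) / a n * B
      = (gg (pgfIter p (r n) (y n)) - gg (y n) - r n * B) / a n := by ring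
    rw [h4, abs_div, abs_of_pos ha]
    calc _ ≤ r n * (ε / (2 * (|ρ| + 1))) / a n := by gcongr
      _ = (r n / a n) * (ε / (2 * (|ρ| + 1))) := by ring
      _ ≤ (|ρ| + 1) * (ε / (2 * (|ρ| + 1))) := by gcongr
      _ = ε / 2 := by field_simp
      _ < ε := by linarith
  have h3 := h2.add h1
  simpa using h3

/-- iterates at zero -/
noncomputable def F0 (p : ℕ → ℝ) (n : ℕ) : ℝ := pgfIter p n 0

lemma Crit.F0_mem (H : Crit p B) (n : ℕ) : 0 ≤ F0 p n ∧ F0 p n < 1 :=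
  H.iter_mem le_rfl zero_lt_one n

lemma F0_succ (p : ℕ → ℝ) (n : ℕ) : F0 p (n+1) = pgf p (F0 p n) := rfl

lemma gg_pos {y : ℝ} (hy : y < 1) : 0 < gg y := inv_pos.2 (by linarith)

lemma Crit.F0_gg_ge (H : Crit p B) (n : ℕ) : n * cf p 0 ≤ gg (F0 p n) := by
  have h := gg_iter p n 0
  have h2 : (n : ℝ) * cf p 0 ≤ ∑ j ∈ Finset.range n, DD p (pgfIter p j 0) := by
    calc (n : ℝ) * cf p 0 = ∑ j ∈ Finset.range n, cf p 0 := by simp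
      _ ≤ _ := Finset.sum_le_sum fun j _ => H.DD_ge (H.F0_mem j).1 (H.F0_mem j).2
  have := gg_pos (zero_lt_one (α := ℝ))
  rw [F0]; linarith

lemma one_sub_inv_gg (y : ℝ) : 1 - (gg y)⁻¹ = y := by simp [gg]

lemma Crit.F0_tendsto (H : Crit p B) : Tendsto (F0 p) atTop (𝓝 1) := by
  have h1 : Tendsto (fun n => gg (F0 p n)) atTop atTop :=
    tendsto_atTop_mono H.F0_gg_ge (tendsto_natCast_atTop_atTop.atTop_mul_const H.cf_zero_pos)
  have h2 := (tendsto_inv_atTop_zero.comp h1).const_sub 1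
  simp only [Function.comp_def, one_sub_inv_gg, sub_zero] at h2
  exact h2

lemma Crit.F0_mono (H : Crit p B) : Monotone (F0 p) :=
  monotone_nat_of_le_succ fun n => H.pgf_ge (H.F0_mem n).1 (H.F0_mem n).2.le

lemma Crit.F0_gg (H : Crit p B) : Tendsto (fun n : ℕ => gg (F0 p n) / n) atTop (𝓝 B) := by
  have h1 := (H.DD_tendsto_seq (Eventually.of_forall H.F0_mem) H.F0_tendsto).cesaro
  have h2 := h1.add ((tendsto_inv_atTop_zero.comp (tendsto_natCast_atTop_atTop (R := ℝ))).const_mul (gg 0))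
  simp only [mul_zero, add_zero] at h2
  refine h2.congr fun n => ?_
  have := gg_iter p n 0
  simp only [F0, Function.comp]
  rw [← this]
  ring

lemma gg_mono {y z : ℝ} (h : y ≤ z) (hz : z < 1) : gg y ≤ gg z :=
  inv_anti₀ (by linarith) (by linarith)

end
end RP

namespace RP
section
variable {p : ℕ → ℝ} {B : ℝ}

lemma Crit.F0_diff (H : Crit p B) {φ : ℕ → ℝ} (hφ : Tendsto φ atTop atTop)
    (hφo : Tendsto (fun n : ℕ => φ n / n) atTop (𝓝 0)) {k : ℕ → ℕ} {κ : ℝ}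
    (hk : Tendsto (fun n => (k n : ℝ) / φ n) atTop (𝓝 κ)) :
    Tendsto (fun n : ℕ => B * (n : ℝ) ^ 2 / φ n * (F0 p (n + k n) - F0 p n)) atTop (𝓝 κ) := by
  have hB := H.hB
  have h1 := H.gg_iter_tendsto (Eventually.of_forall H.F0_mem) H.F0_tendsto
    (hφ.eventually_gt_atTop 0) hk
  have e : ∀ n, pgfIter p (k n) (F0 p n) = F0 p (n + k n) := by
    intro n; rw [F0, F0, ← iter_add, add_comm]
  simp only [e] at h1
  have h2 := H.F0_gg
  have h3 : Tendsto (fun n : ℕ => gg (F0 p (n + k n)) / n) atTop (𝓝 (κ * B * 0 + B)) := by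
    refine ((h1.mul hφo).add h2).congr' ?_
    filter_upwards [hφ.eventually_gt_atTop 0, eventually_gt_atTop 0] with n hn hn0
    have : (0:ℝ) < n := by exact_mod_cast hn0
    field_simp
    ring
  simp only [mul_zero, zero_add] at h3
  have h4 := (h1.const_mul B).div (h3.mul h2) (by positivity)
  have e2 : B * (κ * B) / (B * B) = κ := by field_simp
  rw [e2] at h4
  refine h4.congr' ?_
  filter_upwards [hφ.eventually_gt_atTop 0, eventually_gt_atTop 0] with n hn hn0
  have h0 : (0:ℝ) < n := by exact_mod_cast hn0
  have ha := gg_pos (H.F0_mem n).2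
  have hb := gg_pos (H.F0_mem (n + k n)).2
  have ea := one_sub_inv_gg (F0 p n)
  have eb := one_sub_inv_gg (F0 p (n + k n))
  have : F0 p (n + k n) - F0 p n = (gg (F0 p n))⁻¹ - (gg (F0 p (n + k n)))⁻¹ := by linarith
  rw [this]
  simp only [Pi.div_apply]
  field_simp

lemma Crit.main_diff (H : Crit p B) {φ : ℕ → ℝ} (hφ : Tendsto φ atTop atTop)
    (hφo : Tendsto (fun n : ℕ => φ n / n) atTop (𝓝 0)) {r : ℕ → ℕ} {x c : ℝ} (hx : 0 < x)
    (hr : Tendsto (fun n => (r n : ℝ) / φ n) atTop (𝓝 x)) (hrn : ∀ᶠ n in atTop, r n ≤ n)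
    {y : ℕ → ℝ} (hy : ∀ᶠ n in atTop, F0 p (r n) ≤ y n ∧ y n < 1)
    (hc : Tendsto (fun n => gg (y n) / φ n) atTop (𝓝 (B * c))) :
    Tendsto (fun n : ℕ => B * (n : ℝ) ^ 2 / φ n * (pgfIter p (n - r n) (y n) - F0 p n)) atTop
      (𝓝 (c - x)) := by
  have hB := H.hB
  have hφ0 := hφ.eventually_gt_atTop 0
  have hN : ∀ n, ∃ N, (F0 p (r n) ≤ y n ∧ y n < 1) →
      (r n ≤ N ∧ F0 p N ≤ y n ∧ y n < F0 p (N + 1)) := by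
    intro n
    by_cases h : F0 p (r n) ≤ y n ∧ y n < 1
    · have hex : ∃ j, y n < F0 p j := (H.F0_tendsto.eventually_const_lt h.2).exists
      classical
      have hs := Nat.find_spec hex
      have hgt : r n < Nat.find hex := by
        by_contra hcon
        push Not at hcon
        have := H.F0_mono hcon
        linarith [h.1]
      refine ⟨Nat.find hex - 1, fun _ => ⟨by omega, ?_, ?_⟩⟩
      · exact not_lt.1 (Nat.find_min hex (m := Nat.find hex - 1) (by omega))
      · rwa [Nat.sub_add_cancel (by omega)]
    · exact ⟨0, fun h' => (h h').elim⟩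
  choose N hN using hN
  have hN' : ∀ᶠ n in atTop, r n ≤ N n ∧ F0 p (N n) ≤ y n ∧ y n < F0 p (N n + 1) :=
    hy.mono fun n hn => hN n hn
  have hrr : Tendsto (fun n => (r n : ℝ)) atTop atTop := by
    have := hr.pos_mul_atTop hx hφ
    refine this.congr' ?_
    filter_upwards [hφ0] with n hn
    field_simp
  have hNr : Tendsto (fun n => (N n : ℝ)) atTop atTop :=
    tendsto_atTop_mono' _ (hN'.mono fun n hn => Nat.cast_le.2 hn.1) hrr
  have hNt : Tendsto N atTop atTop := tendsto_natCast_atTop_iff.1 hNr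
  have g1 : Tendsto (fun n => gg (F0 p (N n)) / N n) atTop (𝓝 B) := H.F0_gg.comp hNt
  have g2 : Tendsto (fun n => gg (F0 p (N n + 1)) / N n) atTop (𝓝 B) := by
    have a1 : Tendsto (fun n => gg (F0 p (N n + 1)) / ((N n + 1 : ℕ) : ℝ)) atTop (𝓝 B) :=
      H.F0_gg.comp ((tendsto_add_atTop_nat 1).comp hNt)
    have a2 := (tendsto_inv_atTop_zero.comp hNr).const_add 1
    have a3 := a1.mul a2
    simp only [add_zero, mul_one] at a3
    refine a3.congr' ?_
    filter_upwards [hNr.eventually_gt_atTop 0] with n hn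
    simp only [Function.comp]
    push_cast
    field_simp
  have g3 : Tendsto (fun n => gg (y n) / N n) atTop (𝓝 B) := by
    refine tendsto_of_tendsto_of_tendsto_of_le_of_le' g1 g2 ?_ ?_
    · filter_upwards [hN', hy] with n hn hn2
      exact div_le_div_of_nonneg_right (gg_mono hn.2.1 hn2.2) (Nat.cast_nonneg _)
    · filter_upwards [hN', hy] with n hn hn2
      exact div_le_div_of_nonneg_right (gg_mono hn.2.2.le (H.F0_mem _).2) (Nat.cast_nonneg _)
  have g4 : Tendsto (fun n => (N n : ℝ) / φ n) atTop (𝓝 c) := by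
    have := hc.div g3 hB.ne'
    rw [mul_div_cancel_left₀ _ hB.ne'] at this
    refine this.congr' ?_
    filter_upwards [hy, hφ0, hNr.eventually_gt_atTop 0] with n hn hn2 hn3
    have := gg_pos hn.2
    simp only [Pi.div_apply]
    field_simp
  have k1 : Tendsto (fun n => ((N n - r n : ℕ) : ℝ) / φ n) atTop (𝓝 (c - x)) := by
    refine (g4.sub hr).congr' ?_
    filter_upwards [hN'] with n hn
    rw [Nat.cast_sub hn.1]; ring
  have k2 : Tendsto (fun n => ((N n - r n + 1 : ℕ) : ℝ) / φ n) atTop (𝓝 (c - x)) := by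
    have := k1.add (tendsto_inv_atTop_zero.comp hφ)
    rw [add_zero] at this
    refine this.congr' ?_
    filter_upwards with n
    simp only [Function.comp]
    push_cast; ring
  refine tendsto_of_tendsto_of_tendsto_of_le_of_le' (H.F0_diff hφ hφo k1) (H.F0_diff hφ hφo k2) ?_ ?_
  · filter_upwards [hN', hy, hφ0, hrn] with n hn hn2 hn3 hn4
    have : F0 p (n + (N n - r n)) = pgfIter p (n - r n) (F0 p (N n)) := by
      rw [F0, F0, ← iter_add]; congr 1; omega
    rw [this]
    have := H.iter_mono (H.F0_mem (N n)).1 hn.2.1 hn2.2 (n - r n)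
    gcongr
  · filter_upwards [hN', hy, hφ0, hrn] with n hn hn2 hn3 hn4
    have : F0 p (n + (N n - r n + 1)) = pgfIter p (n - r n) (F0 p (N n + 1)) := by
      rw [F0, F0, ← iter_add]; congr 1; omega
    rw [this]
    have := H.iter_mono ((H.F0_mem (N n)).1.trans hn.2.1) hn.2.2.le (H.F0_mem _).2 (n - r n)
    gcongr

lemma phi_exp {φ : ℕ → ℝ} (hφ : Tendsto φ atTop atTop) (a : ℝ) :
    Tendsto (fun n => φ n * (1 - Real.exp (-(a / φ n)))) atTop (𝓝 a) := by
  have h : HasDerivAt (fun t : ℝ => 1 - Real.exp (-(a * t))) a 0 := by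
    have := (((hasDerivAt_id (0:ℝ)).const_mul a).neg.exp).const_sub 1
    simpa using this
  have h2 := h.tendsto_slope_zero
  have h3 : Tendsto (fun n => (φ n)⁻¹) atTop (𝓝[≠] 0) := by
    rw [tendsto_nhdsWithin_iff]
    refine ⟨tendsto_inv_atTop_zero.comp hφ, ?_⟩
    filter_upwards [hφ.eventually_gt_atTop 0] with n hn
    simp [hn.ne']
  refine (h2.comp h3).congr fun n => ?_
  simp [div_eq_mul_inv]

lemma Crit.laplace (H : Crit p B) {φ : ℕ → ℝ} (hφ : Tendsto φ atTop atTop)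
    (hφo : Tendsto (fun n : ℕ => φ n / n) atTop (𝓝 0)) {x s l : ℝ} (hx : 0 < x)
    (hs0 : 0 ≤ s) (hs1 : s ≤ 1) (hl : 0 < l) :
    Tendsto (fun n : ℕ => B * (n : ℝ) ^ 2 / φ n *
      (pgfIter p (n - ⌊x * φ n⌋₊) (F0 p ⌊x * φ n⌋₊ +
        s * (pgfIter p ⌊x * φ n⌋₊ (Real.exp (-(l / B / φ n))) - F0 p ⌊x * φ n⌋₊)) - F0 p n)) atTop
      (𝓝 (s / (l + (1 - s) / x))) := by
  have hB := H.hB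
  have hφ0 := hφ.eventually_gt_atTop 0
  set r : ℕ → ℕ := fun n => ⌊x * φ n⌋₊ with hrdef
  set u : ℕ → ℝ := fun n => Real.exp (-(l / B / φ n)) with hudef
  have hr : Tendsto (fun n => (r n : ℝ) / φ n) atTop (𝓝 x) :=
    (tendsto_nat_floor_mul_div_atTop hx.le).comp hφ
  have hrr : Tendsto (fun n => (r n : ℝ)) atTop atTop := by
    have := hr.pos_mul_atTop hx hφ
    refine this.congr' ?_
    filter_upwards [hφ0] with n hn
    field_simp
  have hrt : Tendsto r atTop atTop := tendsto_natCast_atTop_iff.1 hrr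
  have hrn : ∀ᶠ n in atTop, r n ≤ n := by
    have := (hr.mul hφo).eventually_lt_const (u := 1) (by simp)
    filter_upwards [this, hφ0, eventually_gt_atTop 0] with n hn hn2 hn3
    have h0 : (0:ℝ) < n := by exact_mod_cast hn3
    have e : (r n : ℝ) / φ n * (φ n / n) = r n / n := by field_simp
    rw [e, div_lt_one h0] at hn
    exact_mod_cast hn.le
  have hu : ∀ᶠ n in atTop, 0 ≤ u n ∧ u n < 1 := by
    filter_upwards [hφ0] with n hn
    refine ⟨(Real.exp_pos _).le, ?_⟩
    rw [hudef]
    simp only [Real.exp_lt_one_iff, neg_lt_zero]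
    positivity
  have hu2 : Tendsto (fun n => φ n * (1 - u n)) atTop (𝓝 (l / B)) := phi_exp hφ (l / B)
  have hu1 : Tendsto u atTop (𝓝 1) := by
    have := (hu2.mul (tendsto_inv_atTop_zero.comp hφ)).const_sub 1
    simp only [mul_zero, sub_zero] at this
    refine this.congr' ?_
    filter_upwards [hφ0] with n hn
    simp only [Function.comp]
    field_simp
    ring
  have hgu : Tendsto (fun n => gg (u n) / φ n) atTop (𝓝 (l / B)⁻¹) := by
    refine (hu2.inv₀ (by positivity)).congr fun n => ?_
    rw [mul_inv, gg]; ring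
  have hG : Tendsto (fun n => gg (pgfIter p (r n) (u n)) / φ n) atTop (𝓝 (x * B + (l / B)⁻¹)) := by
    refine ((H.gg_iter_tendsto hu hu1 hφ0 hr).add hgu).congr fun n => ?_
    ring
  have hG0 : Tendsto (fun n => gg (F0 p (r n)) / φ n) atTop (𝓝 (B * x)) := by
    refine ((H.F0_gg.comp hrt).mul hr).congr' ?_
    filter_upwards [hrr.eventually_gt_atTop 0] with n hn
    simp only [Function.comp]
    field_simp
  have hq : Tendsto (fun n => φ n * (1 - (F0 p (r n) + s * (pgfIter p (r n) (u n) - F0 p (r n))))) atTop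
      (𝓝 ((1 - s) * (B * x)⁻¹ + s * (x * B + (l / B)⁻¹)⁻¹)) := by
    refine (((hG0.inv₀ (by positivity)).const_mul (1 - s)).add
      ((hG.inv₀ (by positivity)).const_mul s)).congr fun n => ?_
    simp only [gg, inv_div, div_inv_eq_mul]
    ring
  have hpos : 0 < (1 - s) * (B * x)⁻¹ + s * (x * B + (l / B)⁻¹)⁻¹ := by
    rcases hs1.lt_or_eq with h | h
    · have : 0 < 1 - s := by linarith
      positivity
    · rw [h]; simp; positivity
  have hden : 0 < l + (1 - s) / x := by
    have : 0 ≤ (1 - s) / x := div_nonneg (by linarith) hx.le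
    linarith
  have hc : Tendsto (fun n => gg (F0 p (r n) + s * (pgfIter p (r n) (u n) - F0 p (r n))) / φ n) atTop
      (𝓝 (B * (x + s / (l + (1 - s) / x)))) := by
    have e : B * (x + s / (l + (1 - s) / x)) =
        ((1 - s) * (B * x)⁻¹ + s * (x * B + (l / B)⁻¹)⁻¹)⁻¹ := by
      have h2 : x * B + (l / B)⁻¹ = B * (1 + l * x) / l := by field_simp; ring
      refine eq_inv_of_mul_eq_one_left ?_
      rw [h2]
      have h3 : 0 < l * x + (1 - s) := by
        have : 0 < l * x := by positivity
        linarith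
      have h4 : l + (1 - s) / x = (l * x + (1 - s)) / x := by field_simp
      rw [h4]
      have h5 : 0 < 1 + l * x := by positivity
      have e1 : x + s / ((l * x + (1 - s)) / x) = x * (1 + l * x) / (l * x + (1 - s)) := by
        rw [div_div_eq_mul_div, eq_div_iff h3.ne', add_mul, div_mul_cancel₀ _ h3.ne']
        ring
      have e2 : (1 - s) * (B * x)⁻¹ + s * (B * (1 + l * x) / l)⁻¹ =
          (l * x + (1 - s)) / (B * x * (1 + l * x)) := by
        field_simp
        ring
      rw [e1, e2]
      generalize l * x + (1 - s) = d at h3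
      field_simp
    rw [e]
    refine (hq.inv₀ hpos.ne').congr fun n => ?_
    rw [mul_inv, gg]; ring
  have hy : ∀ᶠ n in atTop, F0 p (r n) ≤ F0 p (r n) + s * (pgfIter p (r n) (u n) - F0 p (r n)) ∧
      F0 p (r n) + s * (pgfIter p (r n) (u n) - F0 p (r n)) < 1 := by
    filter_upwards [hu] with n hn
    have h1 := H.iter_mono le_rfl hn.1 hn.2 (r n)
    have h2 := (H.iter_mem hn.1 hn.2 (r n)).2
    have h3 : 0 ≤ pgfIter p (r n) (u n) - F0 p (r n) := sub_nonneg.2 h1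
    have h4 := mul_nonneg hs0 h3
    have h5 := mul_le_of_le_one_left h3 hs1
    constructor <;> linarith
  have := H.main_diff hφ hφo hx hr hrn hy hc
  rwa [add_sub_cancel_left] at this

end
end RP

namespace RP

/-- admissible weight and variable -/
structure Good {Ω : Type*} [MeasurableSpace Ω] (μ : Measure Ω) (α W : Ω → ℝ) : Prop where
  int : Integrable α μ
  meas : Measurable W
  pos : ∀ᵐ ω ∂μ, 0 ≤ α ω
  mem : ∀ᵐ ω ∂μ, W ω ∈ Set.Icc (0:ℝ) 1

lemma Good.integrable {Ω : Type*} [MeasurableSpace Ω] {μ : Measure Ω} {α W : Ω → ℝ}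
    (h : Good μ α W) {f : ℝ → ℝ} (hf : Continuous f) : Integrable (fun ω => α ω * f (W ω)) μ := by
  obtain ⟨C, hC⟩ := (isCompact_Icc (a := (0:ℝ)) (b := 1)).exists_bound_of_continuousOn hf.continuousOn
  refine h.int.mul_bdd (c := C) (hf.measurable.comp h.meas).aestronglyMeasurable ?_
  filter_upwards [h.mem] with ω hω using hC _ hω

lemma Good.approx {Ω : Type*} [MeasurableSpace Ω] {μ : Measure Ω} {α W : Ω → ℝ}
    (h : Good μ α W) {f g : ℝ → ℝ} (hf : Continuous f) (hg : Continuous g) {ε : ℝ}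
    (hfg : ∀ x ∈ Set.Icc (0:ℝ) 1, |f x - g x| ≤ ε) :
    |∫ ω, α ω * f (W ω) ∂μ - ∫ ω, α ω * g (W ω) ∂μ| ≤ ε * ∫ ω, α ω ∂μ := by
  rw [← integral_sub (h.integrable hf) (h.integrable hg), ← integral_const_mul]
  refine (abs_integral_le_integral_abs).trans (integral_mono_ae ?_ (h.int.const_mul ε) ?_)
  · exact ((h.integrable hf).sub (h.integrable hg)).abs
  · filter_upwards [h.mem, h.pos] with ω h1 h2
    rw [← mul_sub, abs_mul, abs_of_nonneg h2, mul_comm]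
    exact mul_le_mul_of_nonneg_right (hfg _ h1) h2

lemma weier {Ω Ω' : Type*} [MeasurableSpace Ω] [MeasurableSpace Ω'] {μ : Measure Ω}
    {ν : Measure Ω'} {α W : ℕ → Ω → ℝ} {β V : Ω' → ℝ} (h : ∀ᶠ n in atTop, Good μ (α n) (W n))
    (h' : Good ν β V)
    (hm : ∀ k : ℕ, Tendsto (fun n => ∫ ω, α n ω * W n ω ^ k ∂μ) atTop
      (𝓝 (∫ ω, β ω * V ω ^ k ∂ν))) {f : ℝ → ℝ} (hf : Continuous f) :
    Tendsto (fun n => ∫ ω, α n ω * f (W n ω) ∂μ) atTop (𝓝 (∫ ω, β ω * f (V ω) ∂ν)) := by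
  have hP : ∀ P : Polynomial ℝ, Tendsto (fun n => ∫ ω, α n ω * P.eval (W n ω) ∂μ) atTop
      (𝓝 (∫ ω, β ω * P.eval (V ω) ∂ν)) := by
    intro P
    induction P using Polynomial.induction_on' with
    | add P Q hP hQ =>
      have e : ∀ {Ω'' : Type _} [MeasurableSpace Ω''] {μ : Measure Ω''} {α W : Ω'' → ℝ},
          Good μ α W → ∫ ω, α ω * (P + Q).eval (W ω) ∂μ =
          ∫ ω, α ω * P.eval (W ω) ∂μ + ∫ ω, α ω * Q.eval (W ω) ∂μ := by
        intro _ _ _ _ _ hg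
        rw [← integral_add (hg.integrable P.continuous) (hg.integrable Q.continuous)]
        simp [mul_add]
      have e' : ∫ ω, β ω * (P + Q).eval (V ω) ∂ν =
          ∫ ω, β ω * P.eval (V ω) ∂ν + ∫ ω, β ω * Q.eval (V ω) ∂ν := by
        rw [← integral_add (h'.integrable P.continuous) (h'.integrable Q.continuous)]
        simp [mul_add]
      rw [e']
      refine (hP.add hQ).congr' ?_
      filter_upwards [h] with n hn
      rw [e hn]
    | monomial k c =>
      have := (hm k).const_mul c
      simp only [← integral_const_mul] at this
      have e : ∀ a v : ℝ, a * (Polynomial.monomial k c).eval v = c * (a * v ^ k) := by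
        intro a v; rw [Polynomial.eval_monomial]; ring
      simpa only [e] using this
  have hM := hm 0
  simp only [pow_zero, mul_one] at hM
  set M := ∫ ω, β ω ∂ν with hMdef
  have hM0 : 0 ≤ M := integral_nonneg_of_ae h'.pos
  rw [Metric.tendsto_nhds]
  intro ε hε
  obtain ⟨P, hPf⟩ := exists_polynomial_near_of_continuousOn 0 1 f hf.continuousOn
    (ε / (3 * (M + 1))) (by positivity)
  have hd : ∀ x ∈ Set.Icc (0:ℝ) 1, |P.eval x - f x| ≤ ε / (3 * (M + 1)) :=
    fun x hx => (hPf x hx).le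
  have a2 := h'.approx P.continuous hf hd
  filter_upwards [h, hM.eventually_lt_const (lt_add_one M),
    Metric.tendsto_nhds.1 (hP P) (ε / 3) (by positivity)] with n hn hMn hPn
  have a1 := hn.approx P.continuous hf hd
  have b1 : ε / (3 * (M + 1)) * ∫ ω, α n ω ∂μ ≤ ε / 3 := by
    calc _ ≤ ε / (3 * (M + 1)) * (M + 1) := by gcongr
      _ = ε / 3 := by field_simp
  have b2 : ε / (3 * (M + 1)) * M ≤ ε / 3 := by
    calc _ ≤ ε / (3 * (M + 1)) * (M + 1) := by gcongr; linarith
      _ = ε / 3 := by field_simp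
  rw [Real.dist_eq] at hPn ⊢
  have c1 := abs_le.1 (a1.trans b1)
  have c2 := abs_le.1 (a2.trans b2)
  have c3 := abs_lt.1 hPn
  rw [abs_lt]
  constructor <;> linarith [c1.1, c1.2, c2.1, c2.2, c3.1, c3.2]

/-- truncated logarithm -/
noncomputable def TT (w : ℝ) : ℝ := -Real.log (max w (Real.exp (-2)))

lemma TT_cont : Continuous TT := by
  unfold TT
  refine (Continuous.log (by fun_prop) fun w => ?_).neg
  have : 0 < max w (Real.exp (-2)) := lt_max_of_lt_right (Real.exp_pos _)
  exact this.ne'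

lemma TT_exp (t : ℝ) : TT (Real.exp (-t)) = min t 2 := by
  rw [TT]
  rcases le_total t 2 with h | h
  · rw [max_eq_left (by gcongr), Real.log_exp, min_eq_left h]; ring
  · rw [max_eq_right (by gcongr), Real.log_exp, min_eq_right h]; ring

lemma TT_G {G : ℝ → ℝ} (hG : ∀ t, 2 ≤ t → G t = 0) (t : ℝ) :
    Real.exp (-t) * (G (TT (Real.exp (-t))) * Real.exp (TT (Real.exp (-t)))) = G t := by
  rw [TT_exp]
  rcases le_total t 2 with h | h
  · rw [min_eq_left h, mul_comm, mul_assoc, ← Real.exp_add]; simp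
  · rw [min_eq_right h, hG 2 le_rfl, hG t h]; simp

/-- ramp function -/
noncomputable def ramp (c δ t : ℝ) : ℝ := max 0 (min 1 ((c - t) / δ))

lemma ramp_cont (c δ : ℝ) : Continuous (ramp c δ) := by
  unfold ramp; fun_prop

lemma ramp_nonneg (c δ t : ℝ) : 0 ≤ ramp c δ t := le_max_left _ _
lemma ramp_le_one (c δ t : ℝ) : ramp c δ t ≤ 1 := max_le zero_le_one (min_le_left _ _)
lemma ramp_zero {c δ t : ℝ} (hδ : 0 < δ) (h : c ≤ t) : ramp c δ t = 0 :=
  max_eq_left ((min_le_right _ _).trans (div_nonpos_of_nonpos_of_nonneg (by linarith) hδ.le))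
lemma ramp_one {c δ t : ℝ} (hδ : 0 < δ) (h : t ≤ c - δ) : ramp c δ t = 1 := by
  have : 1 ≤ (c - t) / δ := by rw [le_div_iff₀ hδ]; linarith
  rw [ramp, min_eq_left this, max_eq_right zero_le_one]

lemma good_exp {Ω : Type*} [MeasurableSpace Ω] {μ : Measure Ω} {a X : Ω → ℝ}
    (hX : Measurable X) (hX0 : ∀ ω, 0 ≤ X ω) (ha0 : ∀ ω, 0 ≤ a ω) (hai : Integrable a μ) :
    Good μ (fun ω => a ω * Real.exp (-X ω)) (fun ω => Real.exp (-X ω)) where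
  int := by
    refine hai.mul_bdd (c := 1) (hX.neg.exp).aestronglyMeasurable (ae_of_all _ fun ω => ?_)
    rw [Real.norm_of_nonneg (Real.exp_pos _).le]
    exact Real.exp_le_one_iff.2 (neg_nonpos.2 (hX0 ω))
  meas := hX.neg.exp
  pos := ae_of_all _ fun ω => mul_nonneg (ha0 ω) (Real.exp_pos _).le
  mem := ae_of_all _ fun ω => ⟨(Real.exp_pos _).le, Real.exp_le_one_iff.2 (neg_nonpos.2 (hX0 ω))⟩

lemma taub {Ω : Type*} [MeasurableSpace Ω] {μ : Measure Ω} {a X : ℕ → Ω → ℝ}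
    (hX : ∀ n, Measurable (X n)) (hX0 : ∀ᶠ n in atTop, ∀ ω, 0 ≤ X n ω)
    (ha0 : ∀ᶠ n in atTop, ∀ ω, 0 ≤ a n ω) (hai : ∀ n, Integrable (a n) μ) {s b : ℝ}
    (hs : 0 ≤ s) (hb : 0 ≤ b)
    (hL : ∀ l > 0, Tendsto (fun n => ∫ ω, a n ω * Real.exp (-(l * X n ω)) ∂μ) atTop
      (𝓝 (s / (l + b)))) :
    Tendsto (fun n => ∫ ω in {ω | X n ω ≤ 1}, a n ω ∂μ) atTop
      (𝓝 (∫ t in (0:ℝ)..1, s * Real.exp (-(b * t)))) := by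
  set w : ℝ → ℝ := fun t => s * Real.exp (-(b * t)) with hw
  have hwc : Continuous w := by rw [hw]; fun_prop
  have hw0 : ∀ t, 0 ≤ w t := fun t => mul_nonneg hs (Real.exp_pos _).le
  have hgood : ∀ᶠ n in atTop, Good μ (fun ω => a n ω * Real.exp (-X n ω))
      (fun ω => Real.exp (-X n ω)) := by
    filter_upwards [hX0, ha0] with n h1 h2 using good_exp (hX n) h1 h2 (hai n)
  have hgood' : Good (volume.restrict (Set.Ioi (0:ℝ))) (fun t => w t * Real.exp (-t))
      (fun t => Real.exp (-t)) := by
    refine ⟨?_, by fun_prop, ae_of_all _ fun t => mul_nonneg (hw0 t) (Real.exp_pos _).le, ?_⟩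
    · have := (integrableOn_exp_mul_Ioi (a := -(b + 1)) (by linarith) 0).const_mul s
      refine this.congr (ae_of_all _ fun t => ?_)
      simp only [hw]
      rw [mul_assoc, ← Real.exp_add]; congr 2; ring
    · filter_upwards [ae_restrict_mem measurableSet_Ioi] with t ht
      have ht : 0 < t := ht
      exact ⟨(Real.exp_pos _).le, Real.exp_le_one_iff.2 (by linarith)⟩
  have hm : ∀ k : ℕ, Tendsto (fun n => ∫ ω, a n ω * Real.exp (-X n ω) * Real.exp (-X n ω) ^ k ∂μ)
      atTop (𝓝 (∫ t, w t * Real.exp (-t) * Real.exp (-t) ^ k ∂(volume.restrict (Set.Ioi (0:ℝ))))) := by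
    intro k
    have hk : (0:ℝ) ≤ k := Nat.cast_nonneg k
    have e : ∫ t, w t * Real.exp (-t) * Real.exp (-t) ^ k ∂(volume.restrict (Set.Ioi (0:ℝ)))
        = s / ((k + 1 : ℝ) + b) := by
      have h1 := integral_exp_mul_Ioi (a := -(k + 1 + b)) (by linarith) 0
      have h2 : ∀ t, w t * Real.exp (-t) * Real.exp (-t) ^ k = s * Real.exp (-(k + 1 + b) * t) := by
        intro t
        rw [← Real.exp_nat_mul, hw]
        simp only
        rw [mul_assoc, mul_assoc, ← Real.exp_add, ← Real.exp_add]; congr 2; ring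
      simp only [h2]
      rw [integral_const_mul, h1]
      rw [neg_div_neg_eq, mul_zero, Real.exp_zero, mul_one_div]
    rw [e]
    refine (hL (k + 1) (by linarith)).congr fun n => ?_
    congr 1
    ext ω
    rw [← Real.exp_nat_mul, mul_assoc, ← Real.exp_add]; congr 2; ring
  have hG : ∀ G : ℝ → ℝ, Continuous G → (∀ t, 2 ≤ t → G t = 0) →
      (∀ᶠ n in atTop, Integrable (fun ω => a n ω * G (X n ω)) μ) ∧
      IntegrableOn (fun t => w t * G t) (Set.Ioi 0) ∧
      Tendsto (fun n => ∫ ω, a n ω * G (X n ω) ∂μ) atTop (𝓝 (∫ t in Set.Ioi (0:ℝ), w t * G t)) := by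
    intro G hGc hG0
    have hf : Continuous fun v => G (TT v) * Real.exp (TT v) :=
      (hGc.comp TT_cont).mul (TT_cont.rexp)
    have h1 := weier hgood hgood' hm hf
    simp only [mul_assoc, TT_G hG0] at h1
    refine ⟨?_, ?_, h1⟩
    · filter_upwards [hgood] with n hn
      have := hn.integrable hf
      simpa only [mul_assoc, TT_G hG0] using this
    · have := hgood'.integrable hf
      simp only [mul_assoc, TT_G hG0] at this
      exact this
  set J : ℝ → ℝ := fun c => ∫ t in (0:ℝ)..c, w t with hJ
  have hJc : Continuous J :=
    intervalIntegral.continuous_primitive (fun a b => hwc.intervalIntegrable a b) 0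
  have hwi : ∀ c : ℝ, IntegrableOn w (Set.Ioc 0 c) := fun c =>
    (hwc.integrableOn_Icc).mono_set Set.Ioc_subset_Icc_self
  change Tendsto _ _ (𝓝 (J 1))
  rw [tendsto_order]
  have hsm : ∀ n, MeasurableSet {ω | X n ω ≤ 1} := fun n => measurableSet_le (hX n) measurable_const
  constructor
  · intro a' ha'
    obtain ⟨δ, hδ0, hδ1, hδ⟩ : ∃ δ : ℝ, 0 < δ ∧ δ < 1 ∧ a' < J (1 - δ) := by
      have h1 : Tendsto (fun δ : ℝ => J (1 - δ)) (𝓝[>] 0) (𝓝 (J 1)) := by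
        have : Continuous fun δ : ℝ => J (1 - δ) := hJc.comp (by fun_prop)
        have h := this.tendsto 0
        simp only [sub_zero] at h
        exact h.mono_left nhdsWithin_le_nhds
      have h2 : ∀ᶠ δ : ℝ in 𝓝[>] 0, δ ∈ Set.Ioo (0:ℝ) 1 := Ioo_mem_nhdsGT zero_lt_one
      obtain ⟨δ, h3, h4⟩ := ((h1.eventually_const_lt ha').and h2).exists
      exact ⟨δ, h4.1, h4.2, h3⟩
    obtain ⟨i1, i2, i3⟩ := hG (ramp 1 δ) (ramp_cont _ _) fun t ht => ramp_zero hδ0 (by linarith)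
    have hlow : J (1 - δ) ≤ ∫ t in Set.Ioi (0:ℝ), w t * ramp 1 δ t := by
      rw [hJ]
      simp only
      rw [intervalIntegral.integral_of_le (by linarith)]
      calc _ = ∫ t in Set.Ioc 0 (1 - δ), w t * ramp 1 δ t := by
            refine setIntegral_congr_fun measurableSet_Ioc fun t ht => ?_
            simp only [ramp_one hδ0 ht.2, mul_one]
        _ ≤ _ := setIntegral_mono_set i2
            (ae_of_all _ fun t => mul_nonneg (hw0 t) (ramp_nonneg _ _ _))
            (Set.Ioc_subset_Ioi_self).eventuallyLE
    filter_upwards [i1, i3.eventually_const_lt (hδ.trans_le hlow), ha0] with n h1 h2 h3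
    refine h2.trans_le ?_
    rw [← integral_indicator (hsm n)]
    refine integral_mono h1 ((hai n).indicator (hsm n)) fun ω => ?_
    by_cases hω : X n ω ≤ 1
    · rw [Set.indicator_of_mem (show ω ∈ {ω | X n ω ≤ 1} from hω)]
      exact mul_le_of_le_one_right (h3 ω) (ramp_le_one _ _ _)
    · rw [Set.indicator_of_notMem (show ω ∉ {ω | X n ω ≤ 1} from hω)]
      simp only [ramp_zero hδ0 (not_le.1 hω).le, mul_zero, le_refl]
  · intro a' ha'
    obtain ⟨δ, hδ0, hδ1, hδ⟩ : ∃ δ : ℝ, 0 < δ ∧ δ < 1 ∧ J (1 + δ) < a' := by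
      have h1 : Tendsto (fun δ : ℝ => J (1 + δ)) (𝓝[>] 0) (𝓝 (J 1)) := by
        have : Continuous fun δ : ℝ => J (1 + δ) := hJc.comp (by fun_prop)
        have h := this.tendsto 0
        simp only [add_zero] at h
        exact h.mono_left nhdsWithin_le_nhds
      have h2 : ∀ᶠ δ : ℝ in 𝓝[>] 0, δ ∈ Set.Ioo (0:ℝ) 1 := Ioo_mem_nhdsGT zero_lt_one
      obtain ⟨δ, h3, h4⟩ := ((h1.eventually_lt_const ha').and h2).exists
      exact ⟨δ, h4.1, h4.2, h3⟩
    obtain ⟨i1, i2, i3⟩ := hG (ramp (1 + δ) δ) (ramp_cont _ _)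
      fun t ht => ramp_zero hδ0 (by linarith)
    have hup : ∫ t in Set.Ioi (0:ℝ), w t * ramp (1 + δ) δ t ≤ J (1 + δ) := by
      rw [hJ]
      simp only
      rw [intervalIntegral.integral_of_le (by linarith), ← integral_indicator measurableSet_Ioi,
        ← integral_indicator measurableSet_Ioc]
      refine integral_mono (i2.integrable_indicator measurableSet_Ioi)
        ((hwi _).integrable_indicator measurableSet_Ioc) fun t => ?_
      by_cases h1 : 0 < t
      · rw [Set.indicator_of_mem (show t ∈ Set.Ioi 0 from h1)]
        by_cases h2 : t ≤ 1 + δ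
        · rw [Set.indicator_of_mem (show t ∈ Set.Ioc 0 (1 + δ) from ⟨h1, h2⟩)]
          exact mul_le_of_le_one_right (hw0 t) (ramp_le_one _ _ _)
        · rw [Set.indicator_of_notMem (fun h => h2 h.2), ramp_zero hδ0 (not_le.1 h2).le, mul_zero]
      · rw [Set.indicator_of_notMem (show t ∉ Set.Ioi 0 from h1),
          Set.indicator_of_notMem (fun h => h1 h.1)]
    filter_upwards [i1, i3.eventually_lt_const (hup.trans_lt hδ), ha0] with n h1 h2 h3
    refine lt_of_le_of_lt ?_ h2
    rw [← integral_indicator (hsm n)]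
    refine integral_mono ((hai n).indicator (hsm n)) h1 fun ω => ?_
    by_cases hω : X n ω ≤ 1
    · rw [Set.indicator_of_mem (show ω ∈ {ω | X n ω ≤ 1} from hω)]
      simp only [ramp_one (c := 1 + δ) hδ0 (show X n ω ≤ 1 + δ - δ by linarith), mul_one, le_refl]
    · rw [Set.indicator_of_notMem (show ω ∉ {ω | X n ω ≤ 1} from hω)]
      exact mul_nonneg (h3 ω) (ramp_nonneg _ _ _)

lemma int_val {s x : ℝ} (hx : 0 < x) (hs : s < 1) :
    ∫ t in (0:ℝ)..1, s * Real.exp (-((1 - s) / x * t)) =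
      s * x * (1 - Real.exp (-(1 - s) / x)) / (1 - s) := by
  have h1 : (1 - s) / x ≠ 0 := (div_pos (by linarith) hx).ne'
  have h2 : 1 - s ≠ 0 := by linarith
  have e : ∀ t : ℝ, s * Real.exp (-((1 - s) / x * t)) = s * Real.exp ((-((1 - s) / x)) * t) := by
    intro t; congr 2; ring
  simp only [e]
  rw [intervalIntegral.integral_const_mul,
    intervalIntegral.integral_comp_mul_left (fun t => Real.exp t) (neg_ne_zero.2 h1), integral_exp]
  simp only [mul_zero, mul_one, Real.exp_zero, smul_eq_mul]
  rw [neg_div]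
  field_simp
  ring
end RP

theorem reduced_process_generating_limit    (p : ℕ → ℝ) (hp0 : ∀ k, 0 ≤ p k) (hp1 : ∑' k, p k = 1)
    (hmean : ∑' k : ℕ, (k : ℝ) * p k = 1) (B : ℝ) (hB : 0 < B)
    (hsq : Summable fun k : ℕ => (k : ℝ) ^ 2 * p k)
    (hvar : (∑' k : ℕ, (k : ℝ) ^ 2 * p k) - 1 = 2 * B)
    (hgcd : ∀ d : ℕ, (∀ k, 0 < p k → d ∣ k) → d = 1)
    {Ω : Type*} [MeasurableSpace Ω] (μ : Measure Ω) [IsProbabilityMeasure μ]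
    (Z : ℕ → Ω → ℕ) (hZm : ∀ n, Measurable (Z n))
    (hZ : ∀ n, ∀ s ∈ Set.Icc (0 : ℝ) 1, ∫ ω, s ^ Z n ω ∂μ = pgfIter p n s)
    (Zred : ℕ → ℕ → Ω → ℕ) (hZredm : ∀ m n, Measurable (Zred m n))
    (hjoint : ∀ m n, m ≤ n → ∀ s ∈ Set.Icc (0 : ℝ) 1, ∀ u ∈ Set.Icc (0 : ℝ) 1,
      ∫ ω, s ^ Zred m n ω * u ^ Z n ω ∂μ =
        pgfIter p m (pgfIter p (n - m) 0 +
          s * (pgfIter p (n - m) u - pgfIter p (n - m) 0)))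
    (φ : ℕ → ℝ) (hφ : Tendsto φ atTop atTop)
    (hφo : (fun n : ℕ => φ n) =o[atTop] fun n : ℕ => (n : ℝ)) :
    ∀ x : ℝ, 0 < x → ∀ s ∈ Set.Icc (0 : ℝ) 1,
      Tendsto (fun n : ℕ =>
          (∫ ω in {ω | 0 < Z n ω ∧ (Z n ω : ℝ) ≤ B * φ n},
              s ^ Zred (n - ⌊x * φ n⌋₊) n ω ∂μ) /
            (μ {ω | 0 < Z n ω ∧ (Z n ω : ℝ) ≤ B * φ n}).toReal)
        atTop
        (𝓝 (if s = 1 then 1 else s * x * (1 - Real.exp (-(1 - s) / x)) / (1 - s))) := by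
  have H : RP.Crit p B := ⟨hp0, hp1, hmean, hB, hsq, hvar⟩
  have hφ0 := hφ.eventually_gt_atTop 0
  have hφo' : Tendsto (fun n : ℕ => φ n / n) atTop (𝓝 0) := hφo.tendsto_div_nhds_zero
  intro x hx
  have key : ∀ s ∈ Set.Icc (0:ℝ) 1, Tendsto (fun n : ℕ => B * (n : ℝ) ^ 2 / φ n *
      ∫ ω in {ω | 0 < Z n ω ∧ (Z n ω : ℝ) ≤ B * φ n}, s ^ Zred (n - ⌊x * φ n⌋₊) n ω ∂μ) atTop
      (𝓝 (∫ t in (0:ℝ)..1, s * Real.exp (-((1 - s) / x * t)))) := by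
    intro s hs
    have hsi : ∀ n, Integrable (fun ω => s ^ Zred (n - ⌊x * φ n⌋₊) n ω) μ := by
      intro n
      refine Integrable.of_bound (C := 1)
        ((measurable_from_nat (f := fun k => s ^ k)).comp (hZredm _ n)).aestronglyMeasurable
        (ae_of_all _ fun ω => ?_)
      rw [Real.norm_of_nonneg (pow_nonneg hs.1 _)]
      exact pow_le_one₀ hs.1 hs.2
    have hsu : ∀ n, ∀ u ∈ Set.Icc (0:ℝ) 1,
        Integrable (fun ω => s ^ Zred (n - ⌊x * φ n⌋₊) n ω * u ^ Z n ω) μ := by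
      intro n u hu
      refine (hsi n).mul_bdd (c := 1)
        ((measurable_from_nat (f := fun k => u ^ k)).comp (hZm n)).aestronglyMeasurable
        (ae_of_all _ fun ω => ?_)
      rw [Real.norm_of_nonneg (pow_nonneg hu.1 _)]
      exact pow_le_one₀ hu.1 hu.2
    have h0mem : (0:ℝ) ∈ Set.Icc (0:ℝ) 1 := ⟨le_rfl, zero_le_one⟩
    have hT := RP.taub (μ := μ) (s := s) (b := (1 - s) / x)
      (a := fun n ω => B * (n : ℝ) ^ 2 / φ n *
        (s ^ Zred (n - ⌊x * φ n⌋₊) n ω - s ^ Zred (n - ⌊x * φ n⌋₊) n ω * (0:ℝ) ^ Z n ω))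
      (X := fun n ω => (Z n ω : ℝ) / (B * φ n))
      (fun n => (measurable_from_nat (f := fun k : ℕ => (k : ℝ) / (B * φ n))).comp (hZm n))
      (by filter_upwards [hφ0] with n hn ω; positivity)
      (by
        filter_upwards [hφ0] with n hn ω
        have h1 : (0:ℝ) ^ Z n ω ≤ 1 := pow_le_one₀ le_rfl zero_le_one
        have h2 := pow_nonneg hs.1 (Zred (n - ⌊x * φ n⌋₊) n ω)
        have h3 := mul_le_of_le_one_right h2 h1
        have h4 := sub_nonneg.2 h3
        positivity)
      (fun n => ((hsi n).sub (hsu n 0 h0mem)).const_mul _)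
      hs.1 (div_nonneg (by linarith [hs.2]) hx.le)
      (by
        intro l hl
        refine (H.laplace hφ hφo' hx hs.1 hs.2 hl).congr' ?_
        have hrn : ∀ᶠ n : ℕ in atTop, ⌊x * φ n⌋₊ ≤ n := by
          have := (hφo'.const_mul x).eventually_lt_const (u := 1) (by simp)
          filter_upwards [this, hφ0, eventually_gt_atTop 0] with n hn hn2 hn3
          have h0 : (0:ℝ) < n := by exact_mod_cast hn3
          rw [← mul_div_assoc, div_lt_one h0] at hn
          exact Nat.floor_le_of_le hn.le
        filter_upwards [hφ0, hrn] with n hn hrn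
        have hu : Real.exp (-(l / B / φ n)) ∈ Set.Icc (0:ℝ) 1 := by
          refine ⟨(Real.exp_pos _).le, Real.exp_le_one_iff.2 ?_⟩
          rw [neg_nonpos]; positivity
        have j1 := hjoint (n - ⌊x * φ n⌋₊) n (Nat.sub_le _ _) s hs _ hu
        have j0 := hjoint (n - ⌊x * φ n⌋₊) n (Nat.sub_le _ _) s hs 0 h0mem
        rw [Nat.sub_sub_self hrn] at j1 j0
        rw [sub_self, mul_zero, add_zero, ← RP.iter_add, Nat.sub_add_cancel hrn] at j0
        simp only [RP.F0]
        rw [← j1, ← j0, ← integral_sub (hsu n _ hu) (hsu n 0 h0mem), ← integral_const_mul]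
        congr 1
        ext ω
        rw [← Real.exp_nat_mul]
        have e : -(l * ((Z n ω : ℝ) / (B * φ n))) = (Z n ω : ℝ) * -(l / B / φ n) := by
          field_simp
        rw [e]
        rcases Nat.eq_zero_or_pos (Z n ω) with h | h
        · rw [h]; simp
        · rw [zero_pow h.ne']; ring)
    refine hT.congr' ?_
    filter_upwards [hφ0] with n hn
    have hBφ : 0 < B * φ n := by positivity
    rw [integral_const_mul]
    congr 1
    have m1 : MeasurableSet {ω | (Z n ω : ℝ) / (B * φ n) ≤ 1} :=
      measurableSet_le ((measurable_from_nat (f := fun k : ℕ => (k : ℝ) / (B * φ n))).comp (hZm n))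
        measurable_const
    have m2 : MeasurableSet {ω | 0 < Z n ω ∧ (Z n ω : ℝ) ≤ B * φ n} :=
      (hZm n) (MeasurableSet.of_discrete (s := {k : ℕ | 0 < k ∧ (k : ℝ) ≤ B * φ n}))
    rw [← integral_indicator m1, ← integral_indicator m2]
    congr 1
    ext ω
    simp only [Set.indicator, Set.mem_ofPred_eq, div_le_one hBφ]
    rcases Nat.eq_zero_or_pos (Z n ω) with h | h
    · simp [h]
    · simp [h, h.ne']
  have kone := key 1 ⟨zero_le_one, le_rfl⟩
  simp only [one_pow, sub_self, zero_div, zero_mul, neg_zero, Real.exp_zero, mul_one,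
    intervalIntegral.integral_const, sub_zero, smul_eq_mul, setIntegral_const] at kone
  intro s hs
  have hr := (key s hs).div kone one_ne_zero
  rw [div_one] at hr
  have hv : (∫ t in (0:ℝ)..1, s * Real.exp (-((1 - s) / x * t))) =
      if s = 1 then 1 else s * x * (1 - Real.exp (-(1 - s) / x)) / (1 - s) := by
    split_ifs with h
    · rw [h]; simp
    · exact RP.int_val hx (lt_of_le_of_ne hs.2 h)
  rw [hv] at hr
  refine hr.congr' ?_
  filter_upwards [hφ0, eventually_gt_atTop 0] with n hn hn0
  have h0 : (0:ℝ) < n := by exact_mod_cast hn0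
  have hC : B * (n : ℝ) ^ 2 / φ n ≠ 0 := by positivity
  simp only [Pi.div_apply]
  rw [mul_div_mul_left _ _ hC]
  rfl
end

section
/- Under criticality (E[ξ]=1, Var(ξ)=2B ∈ (0,∞)), for any fixed t ∈ [0,1) and j ≥ 1, P(Z(⌊nt⌋, n) = j) ~ ((1-t)/(Bn)) t^{j-1} as n → ∞. -/
open MeasureTheory Filter Topology Asymptotics Real

lemma coef_lim (d : ℕ → ℕ → ℝ) (C : ℝ) (hs : ∀ n, Summable fun i => |d n i|)
    (hC : ∀ᶠ n in atTop, ∑' i, |d n i| ≤ C)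
    (h : ∀ s ∈ Set.Ioo (0:ℝ) 1, Tendsto (fun n => ∑' i, d n i * s ^ i) atTop (𝓝 0)) (j : ℕ) :
    Tendsto (fun n => d n j) atTop (𝓝 0) := by
  induction j using Nat.strong_induction_on with
  | _ j ih =>
  have hC0 : 0 ≤ C := by
    obtain ⟨n, hn⟩ := hC.exists
    exact (tsum_nonneg fun i => abs_nonneg _).trans hn
  -- key inequality
  have key : ∀ s ∈ Set.Ioo (0:ℝ) 1, ∀ n, ∑' i, |d n i| ≤ C →
      |d n j| ≤ (|∑' i, d n i * s ^ i| + ∑ i ∈ Finset.range j, |d n i|) / s ^ j + s * C := by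
    intro s hs' n hn
    obtain ⟨s0, s1⟩ := hs'
    have hsumm : Summable fun i => d n i * s ^ i := by
      refine Summable.of_norm_bounded (hs n) fun i => ?_
      rw [norm_mul, norm_pow, Real.norm_eq_abs, Real.norm_eq_abs, abs_of_pos s0]
      exact mul_le_of_le_one_right (abs_nonneg _) (pow_le_one₀ s0.le s1.le)
    have e1 := hsumm.sum_add_tsum_nat_add (j+1)
    rw [Finset.sum_range_succ] at e1
    have e2 : |∑' i, d n (i + (j+1)) * s ^ (i + (j+1))| ≤ s ^ (j+1) * C := by
      have hs2 : Summable fun i => |d n (i + (j+1))| :=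
        (summable_nat_add_iff (f := fun i => |d n i|) (j+1)).2 (hs n)
      have hle : ∑' i, |d n (i + (j+1))| ≤ C := by
        have := (hs n).sum_add_tsum_nat_add (j+1)
        have h3 : 0 ≤ ∑ i ∈ Finset.range (j+1), |d n i| :=
          Finset.sum_nonneg fun i _ => abs_nonneg _
        linarith
      rw [← Real.norm_eq_abs]
      refine (tsum_of_norm_bounded (hs2.mul_left (s^(j+1))).hasSum ?_).trans ?_
      · intro i
        rw [norm_mul, norm_pow, Real.norm_eq_abs, Real.norm_eq_abs, abs_of_pos s0, mul_comm]
        refine mul_le_mul_of_nonneg_right ?_ (abs_nonneg _)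
        exact pow_le_pow_of_le_one s0.le s1.le (by omega)
      · rw [tsum_mul_left]
        exact mul_le_mul_of_nonneg_left hle (by positivity)
    have e3 : |∑ i ∈ Finset.range j, d n i * s ^ i| ≤ ∑ i ∈ Finset.range j, |d n i| := by
      refine (Finset.abs_sum_le_sum_abs _ _).trans (Finset.sum_le_sum fun i _ => ?_)
      rw [abs_mul, abs_of_pos (pow_pos s0 i)]
      exact mul_le_of_le_one_right (abs_nonneg _) (pow_le_one₀ s0.le s1.le)
    have e4 : |d n j| * s ^ j ≤ |∑' i, d n i * s ^ i| + ∑ i ∈ Finset.range j, |d n i|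
        + s ^ (j+1) * C := by
      have e5 : |d n j| * s ^ j = |d n j * s ^ j| := by rw [abs_mul, abs_of_pos (pow_pos s0 j)]
      rw [e5]
      have : d n j * s ^ j = (∑' i, d n i * s ^ i) - (∑ i ∈ Finset.range j, d n i * s ^ i)
        - ∑' i, d n (i + (j+1)) * s ^ (i + (j+1)) := by linarith
      rw [this]
      refine (abs_sub _ _).trans ?_
      have := abs_sub (∑' i, d n i * s ^ i) (∑ i ∈ Finset.range j, d n i * s ^ i)
      linarith
    have hp := pow_pos s0 j
    have : |d n j| ≤ (|∑' i, d n i * s ^ i| + ∑ i ∈ Finset.range j, |d n i|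
        + s ^ (j+1) * C) / s ^ j := by rwa [le_div_iff₀ hp]
    refine this.trans (le_of_eq ?_)
    field_simp
    ring
  rw [Metric.tendsto_nhds]
  intro ε hε
  obtain ⟨s, hs', hsC⟩ : ∃ s ∈ Set.Ioo (0:ℝ) 1, s * C < ε / 2 := by
    refine ⟨min (1/2) (ε / (4 * (C + 1))), ⟨by positivity, by
      exact lt_of_le_of_lt (min_le_left _ _) (by norm_num)⟩, ?_⟩
    calc _ ≤ (ε / (4 * (C + 1))) * (C+1) := by
          apply mul_le_mul (min_le_right _ _) (by linarith) hC0 (by positivity)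
      _ = ε / 4 := by field_simp
      _ < ε / 2 := by linarith
  have hl : Tendsto (fun n => (|∑' i, d n i * s ^ i| + ∑ i ∈ Finset.range j, |d n i|) / s ^ j)
      atTop (𝓝 0) := by
    have h1 := (h s hs').abs
    have h2 : Tendsto (fun n => ∑ i ∈ Finset.range j, |d n i|) atTop
        (𝓝 (∑ i ∈ Finset.range j, |(0:ℝ)|)) :=
      tendsto_finsetSum _ fun i hi => (ih i (Finset.mem_range.1 hi)).abs
    simpa using (h1.add h2).div_const (s ^ j)
  filter_upwards [hC, hl.eventually (gt_mem_nhds (half_pos hε))] with n hn hn2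
  rw [Real.dist_eq, sub_zero]
  have := key s hs' n hn
  linarith

lemma pgf_struct (p : ℕ → ℝ) (hp0 : ∀ k, 0 ≤ p k) (hp1 : ∑' k, p k = 1)
    (hmean : ∑' k : ℕ, (k : ℝ) * p k = 1) (B : ℝ) (hB : 0 < B)
    (hsq : Summable fun k : ℕ => (k : ℝ) ^ 2 * p k)
    (hvar : (∑' k : ℕ, (k : ℝ) ^ 2 * p k) - 1 = 2 * B) :
    ∃ (G : ℝ → ℝ) (c : ℝ), 0 < c ∧ (∀ x ∈ Set.Ico (0:ℝ) 1, pgf p x = x + (1 - x)^2 * G x) ∧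
      (∀ x ∈ Set.Ico (0:ℝ) 1, c ≤ G x) ∧ (∀ x ∈ Set.Ico (0:ℝ) 1, pgf p x < 1) ∧
      Tendsto G (𝓝[Set.Ico 0 1] 1) (𝓝 B) := by
  have hs0 : Summable p := by
    by_contra h
    rw [tsum_eq_zero_of_not_summable h] at hp1; norm_num at hp1
  have hs1 : Summable fun k : ℕ => (k:ℝ) * p k := by
    by_contra h
    rw [tsum_eq_zero_of_not_summable h] at hmean; norm_num at hmean
  let g : ℕ → ℝ → ℝ := fun k x => ∑ i ∈ Finset.range k, ((k:ℝ) - 1 - i) * x ^ i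
  have gterm : ∀ k i, i ∈ Finset.range k → (0:ℝ) ≤ (k:ℝ) - 1 - i := by
    intro k i hi
    have : i + 1 ≤ k := Finset.mem_range.1 hi
    have : (i:ℝ) + 1 ≤ k := by exact_mod_cast this
    linarith
  have gid : ∀ k x, x ^ k - 1 + k * (1 - x) = (1 - x)^2 * g k x := by
    intro k x
    induction k with
    | zero => simp [g]
    | succ k ih =>
      have e : g (k+1) x = g k x + ∑ i ∈ Finset.range k, x ^ i := by
        simp only [g]
        rw [Finset.sum_range_succ, ← Finset.sum_add_distrib]
        push_cast
        rw [show ((k:ℝ) + 1 - 1 - k) * x ^ k = 0 by ring, add_zero]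
        exact Finset.sum_congr rfl fun i _ => by ring
      have e2 := mul_neg_geom_sum x k
      rw [e, mul_add, ← ih, sq, mul_assoc, e2]
      push_cast; ring
  have g1 : ∀ k, g k 1 = (k:ℝ) * (k - 1) / 2 := by
    intro k
    induction k with
    | zero => simp [g]
    | succ k ih =>
      have e : g (k+1) 1 = g k 1 + k := by
        simp only [g]
        rw [Finset.sum_range_succ]
        push_cast
        simp only [one_pow, mul_one]
        have : ∑ i ∈ Finset.range k, ((k:ℝ) + 1 - 1 - i) =
          ∑ i ∈ Finset.range k, (((k:ℝ) - 1 - i) + 1) := 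
            Finset.sum_congr rfl fun i _ => by ring
        rw [this, Finset.sum_add_distrib]; simp
      rw [e, ih]; push_cast; ring
  have gmono : ∀ k x y, 0 ≤ x → x ≤ y → g k x ≤ g k y := by
    intro k x y hx hxy
    exact Finset.sum_le_sum fun i hi => 
      mul_le_mul_of_nonneg_left (pow_le_pow_left₀ hx hxy i) (gterm k i hi)
  have g0 : ∀ k x, 0 ≤ x → 0 ≤ g k x := by
    intro k x hx
    exact Finset.sum_nonneg fun i hi => mul_nonneg (gterm k i hi) (pow_nonneg hx i)
  have hS1 : HasSum (fun k => p k * g k 1) B := by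
    have := ((hsq.hasSum.sub hs1.hasSum).div_const 2)
    rw [hmean, hvar] at this
    have e : (fun k => p k * g k 1) = fun k : ℕ => ((k:ℝ) ^ 2 * p k - (k:ℝ) * p k) / 2 := by
      ext k; rw [g1]; ring
    rw [e]
    rwa [mul_div_cancel_left₀ B two_ne_zero] at this
  have hS : ∀ x ∈ Set.Icc (0:ℝ) 1, Summable fun k => p k * g k x := by
    intro x hx
    exact Summable.of_nonneg_of_le (fun k => mul_nonneg (hp0 k) (g0 k x hx.1))
      (fun k => mul_le_mul_of_nonneg_left (gmono k x 1 hx.1 hx.2) (hp0 k)) hS1.summable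
  have hS0 : ∀ x ∈ Set.Icc (0:ℝ) 1, Summable fun k => p k * x ^ k := by
    intro x hx
    exact Summable.of_nonneg_of_le (fun k => mul_nonneg (hp0 k) (pow_nonneg hx.1 k))
      (fun k => mul_le_of_le_one_right (hp0 k) (pow_le_one₀ hx.1 hx.2)) hs0
  refine ⟨fun x => ∑' k, p k * g k x, ∑' k, p k * g k 0, ?_, ?_, ?_, ?_, ?_⟩
  · -- positivity
    obtain ⟨k, hk⟩ : ∃ k, p k * g k 1 ≠ 0 := by
      by_contra! hcon
      have := hS1.tsum_eq
      simp [hcon] at this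
      linarith
    refine (hS 0 ⟨le_rfl, zero_le_one⟩).tsum_pos (fun k => mul_nonneg (hp0 k) (g0 k 0 le_rfl)) k ?_
    have hpk : 0 < p k := lt_of_le_of_ne (hp0 k) (fun h => hk (by rw [← h]; ring))
    refine mul_pos hpk ?_
    have hk2 : 2 ≤ k := by
      by_contra! hlt
      apply hk
      rw [g1]
      interval_cases k <;> simp
    have h1 : ((k:ℝ) - 1 - (0:ℕ)) * (0:ℝ) ^ 0 ≤ g k 0 :=
      Finset.single_le_sum (f := fun i : ℕ => ((k:ℝ) - 1 - i) * (0:ℝ) ^ i)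
        (fun i hi => mul_nonneg (gterm k i hi) (pow_nonneg le_rfl i)) 
        (Finset.mem_range.2 (by omega))
    have : (2:ℝ) ≤ k := by exact_mod_cast hk2
    simp at h1
    linarith
  · intro x hx
    have hx' : x ∈ Set.Icc (0:ℝ) 1 := ⟨hx.1, hx.2.le⟩
    have a1 := ((hS0 x hx').hasSum.sub hs0.hasSum).add (hs1.hasSum.mul_right (1-x))
    have a2 := (hS x hx').hasSum.mul_left ((1-x)^2)
    rw [hp1, hmean] at a1
    have : (fun k => p k * x ^ k - p k + (k:ℝ) * p k * (1 - x)) = 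
        fun k => (1-x)^2 * (p k * g k x) := by
      ext k
      have := gid k x
      linear_combination p k * this
    rw [this] at a1
    have := a1.unique a2
    simp only [pgf]
    linarith
  · intro x hx
    exact (hS 0 ⟨le_rfl, zero_le_one⟩).tsum_le_tsum (fun k => 
      mul_le_mul_of_nonneg_left (gmono k 0 x le_rfl hx.1) (hp0 k)) (hS x ⟨hx.1, hx.2.le⟩)
  · intro x hx
    obtain ⟨k, hk⟩ : ∃ k : ℕ, (k:ℝ) * p k ≠ 0 := by
      by_contra! hcon
      simp [hcon] at hmean
    have hpk : 0 < p k := lt_of_le_of_ne (hp0 k) (fun h => hk (by rw [← h]; ring))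
    have hk0 : k ≠ 0 := by rintro rfl; simp at hk
    rw [← hp1]
    refine Summable.tsum_lt_tsum (i := k) (fun k => 
      mul_le_of_le_one_right (hp0 k) (pow_le_one₀ hx.1 hx.2.le)) ?_ (hS0 x ⟨hx.1, hx.2.le⟩) hs0
    exact mul_lt_of_lt_one_right hpk (pow_lt_one₀ hx.1 hx.2 hk0)
  · rw [← hS1.tsum_eq]
    refine tendsto_tsum_of_dominated_convergence hS1.summable (fun k => ?_) ?_
    · have : Continuous (g k) := by
        simp only [g]; fun_prop
      exact ((this.tendsto 1).const_mul (p k)).mono_left nhdsWithin_le_nhds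
    · filter_upwards [self_mem_nhdsWithin] with x hx k
      rw [Real.norm_eq_abs, abs_of_nonneg (mul_nonneg (hp0 k) (g0 k x hx.1))]
      exact mul_le_mul_of_nonneg_left (gmono k x 1 hx.1 hx.2.le) (hp0 k)

/-- Kolmogorov increment. -/
noncomputable def dlt (p : ℕ → ℝ) (x : ℝ) : ℝ := 1 / (1 - pgf p x) - 1 / (1 - x)

lemma dlt_struct (p : ℕ → ℝ) (hp0 : ∀ k, 0 ≤ p k) (hp1 : ∑' k, p k = 1)
    (hmean : ∑' k : ℕ, (k : ℝ) * p k = 1) (B : ℝ) (hB : 0 < B)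
    (hsq : Summable fun k : ℕ => (k : ℝ) ^ 2 * p k)
    (hvar : (∑' k : ℕ, (k : ℝ) ^ 2 * p k) - 1 = 2 * B) :
    ∃ c : ℝ, 0 < c ∧ (∀ x ∈ Set.Ico (0:ℝ) 1, c ≤ dlt p x) ∧
      (∀ x ∈ Set.Ico (0:ℝ) 1, x ≤ pgf p x ∧ pgf p x < 1) ∧
      Tendsto (dlt p) (𝓝[Set.Ico 0 1] 1) (𝓝 B) := by
  obtain ⟨G, c, hc, hG, hcG, hlt, hlim⟩ := pgf_struct p hp0 hp1 hmean B hB hsq hvar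
  have e : ∀ x ∈ Set.Ico (0:ℝ) 1, 0 < 1 - (1 - x) * G x ∧ dlt p x = G x / (1 - (1 - x) * G x) := by
    intro x hx
    have h1 : 0 < 1 - x := by linarith [hx.2]
    have h2 : 0 < 1 - pgf p x := by linarith [hlt x hx]
    have h3 : 1 - pgf p x = (1 - x) * (1 - (1 - x) * G x) := by rw [hG x hx]; ring
    have h4 : 0 < 1 - (1 - x) * G x := by
      rw [h3] at h2
      exact (mul_pos_iff_of_pos_left h1).1 h2
    refine ⟨h4, ?_⟩
    rw [dlt, h3]
    field_simp
    ring
  refine ⟨c, hc, ?_, ?_, ?_⟩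
  · intro x hx
    obtain ⟨h4, h5⟩ := e x hx
    rw [h5]
    refine (hcG x hx).trans ?_
    have hg : 0 < G x := hc.trans_le (hcG x hx)
    rw [le_div_iff₀ h4]
    have : 0 ≤ (1 - x) * G x := mul_nonneg (by linarith [hx.2]) hg.le
    nlinarith
  · intro x hx
    refine ⟨?_, hlt x hx⟩
    rw [hG x hx]
    have hg : 0 < G x := hc.trans_le (hcG x hx)
    have := mul_nonneg (sq_nonneg (1 - x)) hg.le
    linarith
  · have hx : Tendsto (fun x : ℝ => 1 - x) (𝓝[Set.Ico 0 1] 1) (𝓝 0) := by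
      have : Continuous (fun x : ℝ => 1 - x) := by fun_prop
      have := this.tendsto 1
      rw [sub_self] at this
      exact this.mono_left nhdsWithin_le_nhds
    have h1 : Tendsto (fun x => G x / (1 - (1 - x) * G x)) (𝓝[Set.Ico 0 1] 1) 
        (𝓝 (B / (1 - 0 * B))) :=
      hlim.div ((hx.mul hlim).const_sub 1) (by norm_num)
    rw [zero_mul, sub_zero, div_one] at h1
    refine h1.congr' ?_
    filter_upwards [self_mem_nhdsWithin] with x hx
    exact (e x hx).2.symm

lemma iter_mem (p : ℕ → ℝ) (h : ∀ x ∈ Set.Ico (0:ℝ) 1, x ≤ pgf p x ∧ pgf p x < 1)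
    (x : ℝ) (hx : x ∈ Set.Ico (0:ℝ) 1) (k : ℕ) :
    x ≤ pgfIter p k x ∧ pgfIter p k x ∈ Set.Ico (0:ℝ) 1 := by
  induction k with
  | zero => exact ⟨le_rfl, hx⟩
  | succ k ih =>
    have := h _ ih.2
    refine ⟨ih.1.trans this.1, ih.2.1.trans this.1, this.2⟩

lemma iter_tele (p : ℕ → ℝ) (x : ℝ) (m : ℕ) :
    1 / (1 - pgfIter p m x) = 1 / (1 - x) + ∑ k ∈ Finset.range m, dlt p (pgfIter p k x) := by
  induction m with
  | zero => simp [pgfIter]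
  | succ m ih =>
    rw [Finset.sum_range_succ, ← add_assoc, ← ih, dlt]
    simp [pgfIter]

section
variable (p : ℕ → ℝ) (B c : ℝ) (hc : 0 < c) (hcd : ∀ x ∈ Set.Ico (0:ℝ) 1, c ≤ dlt p x)
  (h : ∀ x ∈ Set.Ico (0:ℝ) 1, x ≤ pgf p x ∧ pgf p x < 1)
  (hlim : Tendsto (dlt p) (𝓝[Set.Ico 0 1] 1) (𝓝 B))

include hc hcd h in
lemma Q_lim : Tendsto (fun n => 1 - pgfIter p n 0) atTop (𝓝 0) := by
  have z : (0:ℝ) ∈ Set.Ico (0:ℝ) 1 := ⟨le_rfl, one_pos⟩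
  have hb : ∀ n : ℕ, n * c ≤ (1 - pgfIter p n 0)⁻¹ := by
    intro n
    have := iter_tele p 0 n
    have h2 : ∑ k ∈ Finset.range n, c ≤ ∑ k ∈ Finset.range n, dlt p (pgfIter p k 0) :=
      Finset.sum_le_sum fun k _ => hcd _ (iter_mem p h 0 z k).2
    simp at h2 this
    linarith
  have h1 : Tendsto (fun n : ℕ => (n:ℝ) * c) atTop atTop :=
    tendsto_natCast_atTop_atTop.atTop_mul_const hc
  have := (tendsto_atTop_mono hb h1).inv_tendsto_atTop
  refine this.congr fun n => by simp

include hc hcd h hlim in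
lemma Q_asymp : Tendsto (fun n : ℕ => (n:ℝ)⁻¹ * (1 / (1 - pgfIter p n 0))) atTop (𝓝 B) := by
  have z : (0:ℝ) ∈ Set.Ico (0:ℝ) 1 := ⟨le_rfl, one_pos⟩
  have h1 : Tendsto (fun n => pgfIter p n 0) atTop (𝓝[Set.Ico 0 1] 1) := by
    rw [tendsto_nhdsWithin_iff]
    refine ⟨?_, Eventually.of_forall fun n => (iter_mem p h 0 z n).2⟩
    have := (Q_lim p c hc hcd h).const_sub 1
    simpa using this
  have h2 := (hlim.comp h1).cesaro
  have h3 : Tendsto (fun n : ℕ => (n:ℝ)⁻¹) atTop (𝓝 0) := tendsto_inv_atTop_nhds_zero_nat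
  have := h3.add h2
  rw [zero_add] at this
  refine this.congr fun n => ?_
  rw [iter_tele]; simp; ring

include hc hcd h hlim in
lemma main_lim (hB : 0 < B) (t : ℝ) (ht0 : 0 ≤ t) (ht1 : t < 1) (s : ℝ) (hs0 : 0 ≤ s) (hs1 : s < 1) :
    Tendsto (fun n : ℕ => (n:ℝ) * (1 - pgfIter p ⌊t * (n:ℝ)⌋₊
      (1 - (1 - s) * (1 - pgfIter p (n - ⌊t * (n:ℝ)⌋₊) 0)))) atTop
      (𝓝 ((1 - s) / (B * (1 - t * s)))) := by
  have z : (0:ℝ) ∈ Set.Ico (0:ℝ) 1 := ⟨le_rfl, one_pos⟩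
  set m : ℕ → ℕ := fun n => ⌊t * (n:ℝ)⌋₊ with hm
  have hmle : ∀ n, m n ≤ n := fun n => by
    apply Nat.floor_le_of_le
    exact mul_le_of_le_one_left (Nat.cast_nonneg n) ht1.le
  have hmt : Tendsto (fun n : ℕ => (m n : ℝ) / n) atTop (𝓝 t) :=
    (tendsto_nat_floor_mul_div_atTop ht0).comp tendsto_natCast_atTop_atTop
  have hnm : Tendsto (fun n => n - m n) atTop atTop := by
    have : Tendsto (fun n : ℕ => ((n - m n : ℕ) : ℝ)) atTop atTop := by
      refine tendsto_atTop_mono (f := fun n : ℕ => (n:ℝ) * (1 - t)) ?_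
        (tendsto_natCast_atTop_atTop.atTop_mul_const (by linarith))
      intro n
      rw [Nat.cast_sub (hmle n)]
      have : (m n : ℝ) ≤ t * n := Nat.floor_le (by positivity)
      linarith
    exact tendsto_natCast_atTop_iff.1 this
  set x : ℕ → ℝ := fun n => 1 - (1 - s) * (1 - pgfIter p (n - m n) 0) with hx
  have hxm : ∀ n, x n ∈ Set.Ico (0:ℝ) 1 := by
    intro n
    have := (iter_mem p h 0 z (n - m n)).2
    constructor
    · simp only [hx]; nlinarith [this.1, this.2]
    · simp only [hx]; nlinarith [this.1, this.2]
  have hx1 : Tendsto x atTop (𝓝 1) := by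
    have := (((Q_lim p c hc hcd h).comp hnm).const_mul (1 - s)).const_sub 1
    simpa using this
  -- first term
  have T1 : Tendsto (fun n : ℕ => (n:ℝ)⁻¹ * (1 / (1 - x n))) atTop (𝓝 ((1 - t) * B / (1 - s))) := by
    have a := (((hmt.const_sub 1).mul ((Q_asymp p B c hc hcd h hlim).comp hnm))).div_const (1 - s)
    refine a.congr' ?_
    filter_upwards [eventually_gt_atTop 0, hnm.eventually_gt_atTop 0] with n hn hn2
    have q := (iter_mem p h 0 z (n - m n)).2.2
    have q' : 1 - pgfIter p (n - m n) 0 ≠ 0 := by linarith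
    have s' : 1 - s ≠ 0 := by linarith
    have hn' : (n:ℝ) ≠ 0 := by exact_mod_cast hn.ne'
    have hn2' : (n:ℝ) - m n ≠ 0 := by
      rw [← Nat.cast_sub (hmle n)]; exact_mod_cast hn2.ne'
    simp only [hx, Function.comp, sub_sub_cancel]
    rw [Nat.cast_sub (hmle n)]
    field_simp
  have T2 : Tendsto (fun n : ℕ => (n:ℝ)⁻¹ * ∑ k ∈ Finset.range (m n), dlt p (pgfIter p k (x n)))
      atTop (𝓝 (t * B)) := by
    have T3 : Tendsto (fun n : ℕ => (n:ℝ)⁻¹ * (∑ k ∈ Finset.range (m n), dlt p (pgfIter p k (x n)))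
        - (m n : ℝ) / n * B) atTop (𝓝 0) := by
      rw [Metric.tendsto_nhds]
      intro ε hε
      have h1 := (Metric.tendsto_nhds.1 hlim) (ε / 2) (half_pos hε)
      rw [eventually_nhdsWithin_iff, Metric.eventually_nhds_iff] at h1
      obtain ⟨η, hη, h1⟩ := h1
      filter_upwards [eventually_gt_atTop 0, (Metric.tendsto_nhds.1 hx1) η hη] with n hn hn2
      have hn' : (0:ℝ) < n := by exact_mod_cast hn
      have hk : ∀ k ∈ Finset.range (m n), |dlt p (pgfIter p k (x n)) - B| ≤ ε / 2 := by
        intro k _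
        obtain ⟨i1, i2⟩ := iter_mem p h (x n) (hxm n) k
        refine (h1 ?_ i2).le
        rw [Real.dist_eq, abs_lt] at hn2 ⊢
        constructor <;> linarith [hn2.1, hn2.2, i2.2]
      have e : (n:ℝ)⁻¹ * (∑ k ∈ Finset.range (m n), dlt p (pgfIter p k (x n))) - (m n : ℝ) / n * B
          = (n:ℝ)⁻¹ * ∑ k ∈ Finset.range (m n), (dlt p (pgfIter p k (x n)) - B) := by
        rw [Finset.sum_sub_distrib]; simp; ring
      rw [Real.dist_eq, sub_zero, e, abs_mul, abs_of_pos (inv_pos.2 hn')]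
      have h2 := (Finset.abs_sum_le_sum_abs _ _).trans (Finset.sum_le_sum hk)
      simp only [Finset.sum_const, Finset.card_range, nsmul_eq_mul] at h2
      have h3 : (m n : ℝ) ≤ n := by exact_mod_cast hmle n
      calc _ ≤ (n:ℝ)⁻¹ * (n * (ε / 2)) := by
            refine mul_le_mul_of_nonneg_left (h2.trans ?_) (by positivity)
            exact mul_le_mul_of_nonneg_right h3 (by positivity)
        _ = ε / 2 := by field_simp
        _ < ε := by linarith
    have := T3.add (hmt.mul_const B)
    simpa using this
  have T := (T1.add T2).inv₀ (by
    have : 0 < (1 - t) * B / (1 - s) := div_pos (mul_pos (by linarith) hB) (by linarith)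
    positivity)
  have hts : 0 < 1 - t * s := by nlinarith
  have e : ((1 - t) * B / (1 - s) + t * B)⁻¹ = (1 - s) / (B * (1 - t * s)) := by
    have s' : 1 - s ≠ 0 := by linarith
    rw [show (1 - t) * B / (1 - s) + t * B = (B * (1 - t * s)) / (1 - s) by field_simp; ring]
    rw [inv_div]
  rw [e] at T
  refine T.congr fun n => ?_
  rw [← mul_add, ← iter_tele]
  simp [hm, hx, mul_comm]
end

lemma hs_congr {f g : ℕ → ℝ} {x y : ℝ} (h : HasSum f x) (e : ∀ k, g k = f k) (e' : y = x) :
    HasSum g y := by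
  have : g = f := funext e
  rw [this, e']; exact h

lemma pgf_hasSum {Ω : Type*} [MeasurableSpace Ω] (μ : Measure Ω) [IsProbabilityMeasure μ]
    (X : Ω → ℕ) (hX : Measurable X) (s : ℝ) (hs : s ∈ Set.Icc (0:ℝ) 1) :
    HasSum (fun i => (μ {ω | X ω = i}).toReal * s ^ i) (∫ ω, s ^ X ω ∂μ) := by
  have hint : Integrable (fun ω => s ^ X ω) μ := by
    refine Integrable.of_bound (C := 1) ?_ ?_
    · exact (measurable_from_nat.comp hX : Measurable ((fun k : ℕ => s ^ k) ∘ X)).aestronglyMeasurable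
    · refine Eventually.of_forall fun ω => ?_
      rw [Real.norm_eq_abs, abs_of_nonneg (pow_nonneg hs.1 _)]
      exact pow_le_one₀ hs.1 hs.2
  have hU : (⋃ i : ℕ, {ω | X ω = i}) = Set.univ := by ext ω; simp
  have hm : ∀ i : ℕ, MeasurableSet {ω | X ω = i} := fun i => hX (measurableSet_singleton i)
  have := hasSum_integral_iUnion (μ := μ) (f := fun ω => s ^ X ω) hm ?_ (hint.integrableOn)
  · rw [hU, Measure.restrict_univ] at this
    refine hs_congr this (fun i => ?_) rfl
    rw [setIntegral_congr_fun (g := fun _ => s ^ i) (hm i) (fun ω hω => by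
      have hω' : X ω = i := hω; simp only [hω'])]
    simp [Measure.real]
  · intro i j hij
    rw [Function.onFun, Set.disjoint_left]
    intro ω h1 h2
    exact hij (h1.symm.trans h2)

lemma pgf_hasSum' {Ω : Type*} [MeasurableSpace Ω] (μ : Measure Ω) [IsProbabilityMeasure μ]
    (X : Ω → ℕ) (hX : Measurable X) (s : ℝ) (hs : s ∈ Set.Ioc (0:ℝ) 1) :
    HasSum (fun i => (μ {ω | X ω = i + 1}).toReal * s ^ i)
      (((∫ ω, s ^ X ω ∂μ) - ∫ ω, (0:ℝ) ^ X ω ∂μ) / s) := by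
  have h1 := pgf_hasSum μ X hX s ⟨hs.1.le, hs.2⟩
  have h0 := pgf_hasSum μ X hX 0 ⟨le_rfl, zero_le_one⟩
  have h0' : (μ {ω | X ω = 0}).toReal = ∫ ω, (0:ℝ) ^ X ω ∂μ := by
    rw [← h0.tsum_eq, tsum_eq_single 0]
    · simp
    · intro i hi; simp [hi]
  have h2 := ((hasSum_nat_add_iff' 1).2 h1).div_const s
  simp only [Finset.sum_range_one, pow_zero, mul_one, h0'] at h2
  refine hs_congr h2 (fun i => ?_) rfl
  rw [pow_succ]
  have := hs.1.ne'
  field_simp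

theorem reduced_process_asymptotics_linear    (p : ℕ → ℝ) (hp0 : ∀ k, 0 ≤ p k) (hp1 : ∑' k, p k = 1)
    (hmean : ∑' k : ℕ, (k : ℝ) * p k = 1) (B : ℝ) (hB : 0 < B)
    (hsq : Summable fun k : ℕ => (k : ℝ) ^ 2 * p k)
    (hvar : (∑' k : ℕ, (k : ℝ) ^ 2 * p k) - 1 = 2 * B)
    {Ω : Type*} [MeasurableSpace Ω] (μ : Measure Ω) [IsProbabilityMeasure μ]
    (Z : ℕ → Ω → ℕ) (hZm : ∀ n, Measurable (Z n))
    (hZ : ∀ n, ∀ s ∈ Set.Icc (0 : ℝ) 1, ∫ ω, s ^ Z n ω ∂μ = pgfIter p n s)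
    (Zred : ℕ → ℕ → Ω → ℕ) (hZredm : ∀ m n, Measurable (Zred m n))
    (hjoint : ∀ m n, m ≤ n → ∀ s ∈ Set.Icc (0 : ℝ) 1, ∀ u ∈ Set.Icc (0 : ℝ) 1,
      ∫ ω, s ^ Zred m n ω * u ^ Z n ω ∂μ =
        pgfIter p m (pgfIter p (n - m) 0 +
          s * (pgfIter p (n - m) u - pgfIter p (n - m) 0))) :
    ∀ t : ℝ, 0 ≤ t → t < 1 → ∀ j : ℕ, 1 ≤ j →
      (fun n : ℕ => (μ {ω | Zred ⌊t * (n : ℝ)⌋₊ n ω = j}).toReal) ~[atTop]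
        fun n : ℕ => (1 - t) / (B * n) * t ^ (j - 1) := by
  intro t ht0 ht1 j hj
  obtain ⟨i, rfl⟩ : ∃ i, j = i + 1 := ⟨j - 1, by omega⟩
  obtain ⟨c, hc, hcd, hpg, hlim⟩ := dlt_struct p hp0 hp1 hmean B hB hsq hvar
  have one : ∀ n, pgfIter p n 1 = 1 := by
    intro n
    rw [← hZ n 1 ⟨zero_le_one, le_rfl⟩]; simp
  have hE : ∀ m n, m ≤ n → ∀ s ∈ Set.Icc (0:ℝ) 1, ∫ ω, s ^ Zred m n ω ∂μ =
      pgfIter p m (1 - (1 - s) * (1 - pgfIter p (n - m) 0)) := by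
    intro m n hmn s hs
    have := hjoint m n hmn s hs 1 ⟨zero_le_one, le_rfl⟩
    rw [one] at this
    simp only [one_pow, mul_one] at this
    rw [this]; congr 1; ring
  have z : (0:ℝ) ∈ Set.Icc (0:ℝ) 1 := ⟨le_rfl, zero_le_one⟩
  have o : (1:ℝ) ∈ Set.Icc (0:ℝ) 1 := ⟨zero_le_one, le_rfl⟩
  have hmle : ∀ n : ℕ, ⌊t * (n:ℝ)⌋₊ ≤ n := fun n => by
    apply Nat.floor_le_of_le
    exact mul_le_of_le_one_left (Nat.cast_nonneg n) ht1.le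
  by_cases hdeg : t = 0 ∧ i ≠ 0
  · obtain ⟨rfl, hi⟩ := hdeg
    have hz : ∀ n, (μ {ω | Zred 0 n ω = i + 1}).toReal = 0 := by
      intro n
      set q := pgfIter p n 0 with hq
      let d : ℕ → ℝ := fun k => (μ {ω | Zred 0 n ω = k + 1}).toReal - if k = 0 then 1 - q else 0
      have hs1 : ∀ s ∈ Set.Ioc (0:ℝ) 1, HasSum (fun k => d k * s ^ k) 0 := by
        intro s hs
        have h1 := pgf_hasSum' μ (Zred 0 n) (hZredm 0 n) s hs
        rw [hE 0 n (Nat.zero_le n) s ⟨hs.1.le, hs.2⟩, hE 0 n (Nat.zero_le n) 0 z] at h1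
        have h2 := hasSum_ite_eq 0 (1 - q)
        have h3 := h1.sub h2
        refine hs_congr h3 (fun k => ?_) ?_
        · simp only [d]
          split_ifs with hk
          · simp [hk]
          · simp
        · have := hs.1.ne'
          simp only [pgfIter, Nat.sub_zero, ← hq]
          field_simp
          ring
      have hsum : Summable d := by
        have := (hs1 1 ⟨one_pos, le_rfl⟩).summable
        simpa using this
      have := coef_lim (fun _ => d) (∑' k, |d k|) (fun _ => hsum.abs)
        (Eventually.of_forall fun _ => le_rfl) (fun s hs => by
          rw [(hs1 s ⟨hs.1, hs.2.le⟩).tsum_eq]; exact tendsto_const_nhds) i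
      have h0 : d i = 0 := tendsto_nhds_unique tendsto_const_nhds this
      simpa [d, hi] using h0
    have e1 : (fun n : ℕ => (μ {ω | Zred ⌊(0:ℝ) * (n : ℝ)⌋₊ n ω = i + 1}).toReal) = fun _ => 0 := by
      ext n; simpa using hz n
    have e2 : (fun n : ℕ => (1 - (0:ℝ)) / (B * n) * (0:ℝ) ^ (i + 1 - 1)) = fun _ => 0 := by
      ext n; simp [hi]
    rw [e1, e2]
  have htpos : t ^ i ≠ 0 := by
    by_cases h0 : t = 0
    · have : i = 0 := by by_contra h; exact hdeg ⟨h0, h⟩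
      simp [this]
    · exact pow_ne_zero _ h0
  let a : ℕ → ℕ → ℝ := fun n k => n * (μ {ω | Zred ⌊t * (n:ℝ)⌋₊ n ω = k + 1}).toReal
  let b : ℕ → ℝ := fun k => (1 - t) / B * t ^ k
  have ha0 : ∀ n k, 0 ≤ a n k := fun n k => by positivity
  have hb0 : ∀ k, 0 ≤ b k := fun k => mul_nonneg (div_nonneg (by linarith) hB.le) (by positivity)
  have hbs : ∀ s ∈ Set.Ioc (0:ℝ) 1, HasSum (fun k => b k * s ^ k) ((1 - t) / B * (1 - t * s)⁻¹) := by
    intro s hs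
    have : HasSum (fun k => (t * s) ^ k) (1 - t * s)⁻¹ :=
      hasSum_geometric_of_lt_one (mul_nonneg ht0 hs.1.le) (by nlinarith [hs.1, hs.2])
    refine hs_congr (this.mul_left ((1 - t) / B)) (fun k => ?_) rfl
    simp only [b]; rw [mul_pow]; ring
  let F : ℝ → ℕ → ℝ := fun s n => (n:ℝ) * (1 - pgfIter p ⌊t * (n:ℝ)⌋₊
      (1 - (1 - s) * (1 - pgfIter p (n - ⌊t * (n:ℝ)⌋₊) 0)))
  have has : ∀ n, ∀ s ∈ Set.Ioc (0:ℝ) 1, HasSum (fun k => a n k * s ^ k) ((F 0 n - F s n) / s) := by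
    intro n s hs
    have h1 := (pgf_hasSum' μ _ (hZredm ⌊t * (n:ℝ)⌋₊ n) s hs).mul_left (n:ℝ)
    rw [hE _ n (hmle n) s ⟨hs.1.le, hs.2⟩, hE _ n (hmle n) 0 z] at h1
    refine hs_congr h1 (fun k => ?_) ?_
    · simp only [a]; ring
    · simp only [F]; ring
  have hF : ∀ s, 0 ≤ s → s < 1 → Tendsto (F s) atTop (𝓝 ((1 - s) / (B * (1 - t * s)))) :=
    fun s h0 h1 => main_lim p B c hc hcd hpg hlim hB t ht0 ht1 s h0 h1
  have hF1 : ∀ n, F 1 n = 0 := by intro n; simp [F, one]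
  have o' : (1:ℝ) ∈ Set.Ioc (0:ℝ) 1 := ⟨one_pos, le_rfl⟩
  have hasum : ∀ n, HasSum (a n) (F 0 n) := by
    intro n
    have := has n 1 o'
    simpa [hF1] using this
  have hbsum : Summable b := by
    have := (hbs 1 o').summable
    simpa using this
  have key := coef_lim (fun n k => a n k - b k) (1 / B + 1 + ∑' k, b k)
    (fun n => ((hasum n).summable.sub hbsum).abs) ?_ ?_ i
  · have hlimA : Tendsto (fun n => a n i) atTop (𝓝 (b i)) := by
      have := key.add_const (b i)
      simpa using this
    have hbi : b i ≠ 0 := by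
      have : 1 - t ≠ 0 := by linarith
      simp only [b]
      positivity
    apply isEquivalent_of_tendsto_one
    have := hlimA.div_const (b i)
    rw [div_self hbi] at this
    refine this.congr' ?_
    filter_upwards [eventually_gt_atTop 0] with n hn
    have hn' : (n:ℝ) ≠ 0 := by exact_mod_cast hn.ne'
    have ht' : 1 - t ≠ 0 := by linarith
    simp only [a, b, Pi.div_apply, Nat.add_sub_cancel]
    field_simp
  · have h0 : Tendsto (F 0) atTop (𝓝 (1 / B)) := by simpa using hF 0 le_rfl one_pos
    filter_upwards [h0.eventually (gt_mem_nhds (lt_add_one (1 / B)))] with n hn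
    have h1 : ∑' k, |a n k - b k| ≤ ∑' k, (a n k + b k) := by
      refine ((hasum n).summable.sub hbsum).abs.tsum_le_tsum (fun k => ?_)
        ((hasum n).summable.add hbsum)
      rw [abs_le]; constructor <;> linarith [ha0 n k, hb0 k]
    rw [(hasum n).summable.tsum_add hbsum, (hasum n).tsum_eq] at h1
    linarith
  · intro s hs
    have hs' : s ∈ Set.Ioc (0:ℝ) 1 := ⟨hs.1, hs.2.le⟩
    have h1 := ((hF 0 le_rfl one_pos).sub (hF s hs.1.le hs.2)).div_const s
    have h2 := h1.sub_const ((1 - t) / B * (1 - t * s)⁻¹)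
    have e : ((1 - 0) / (B * (1 - t * 0)) - (1 - s) / (B * (1 - t * s))) / s
        - (1 - t) / B * (1 - t * s)⁻¹ = 0 := by
      have h3 : 1 - t * s ≠ 0 := by nlinarith [hs.1, hs.2]
      have h4 := hs.1.ne'
      rw [mul_zero, sub_zero, mul_one]
      rw [← one_div]
      generalize hw : 1 - t * s = w at h3
      field_simp
      rw [← hw]
      ring
    rw [e] at h2
    refine h2.congr fun n => ?_
    have := ((has n s hs').sub (hbs s hs')).tsum_eq
    rw [← this]
    exact tsum_congr fun k => by ring
end
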